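/- arXiv:1602.02318 — 2 statements merged into one kernel-verified Lean document; each statement's English description precedes it below -/
import Mathlib

section
/- A connected pair (Q,R) (a finite quiver with a set of length-2 relation paths) is isomorphic to the tiling-algebra pair (Q_S, R_S) of some tiling S of a disc with M ≥ 2 marked points if and only if (Q,R) is a gentle pair all of whose cycles are oriented and relation-full. In particular: (a) for every tiling S, the pair (Q_S, R_S) is a gentle pair all of whose cycles are oriented and relation-full; (b) for every connected gentle pair (Q,R) all of whose cycles are oriented and relation-full, there exist M ≥ 2 and a tiling S of a disc with M marked points together with an isomorphism of quivers Q ≅ Q_S carrying R bijectively onto R_S. -/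
namespace PaperTiling

variable {M : ℕ}

/-- `[i,j]`: the number of vertices encountered travelling clockwise from `i` to `j`, inclusive. -/
def cnt (i j : ZMod M) : ℕ := (j - i).val + 1

/-- `C(v₁,…,v_r)`: the entries are pairwise distinct and occur in this clockwise cyclic order. -/
def CW (l : List (ZMod M)) : Prop :=
  l.Nodup ∧ ((l.zip (l.rotate 1)).map fun p => (p.2 - p.1).val).sum = M

/-- Two diagonals cross. -/
def Crosses (d e : Sym2 (ZMod M)) : Prop :=
  ∃ a1 b1 a2 b2 : ZMod M, d = s(a1, a2) ∧ e = s(b1, b2) ∧ CW [a1, b1, a2, b2]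

/-- `d` is an `(m+1)`-diagonal. -/
def IsMDiag (m : ℕ) (d : Sym2 (ZMod M)) : Prop :=
  ¬ d.IsDiag ∧ ∀ i j : ZMod M, d = s(i, j) → (m + 1) ∣ cnt i j

/-- Short diagonal. -/
def IsShort (m : ℕ) (d : Sym2 (ZMod M)) : Prop :=
  ∃ v : ZMod M, d = s(v, v + (m : ZMod M))

/-- Long diagonal. -/
def IsLong (m : ℕ) (d : Sym2 (ZMod M)) : Prop := IsMDiag m d ∧ ¬ IsShort m d

/-- The shift `Σ^k`. -/
def shiftD (k : ℕ) (d : Sym2 (ZMod M)) : Sym2 (ZMod M) :=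
  d.map (fun v => v + (k : ZMod M))

/-- `a` and `b` are `k`-neighbours. -/
def Nbr (k : ℕ) (a b : Sym2 (ZMod M)) : Prop :=
  a ≠ b ∧ ¬ Crosses a b ∧ ∃ v ∈ a, ((v + (k : ZMod M)) ∈ b ∨ (v - (k : ZMod M)) ∈ b)

/-- The Ext-hammock condition `E_k(b,a)`. -/
def Ek (m k : ℕ) (b a : Sym2 (ZMod M)) : Prop :=
  (Nbr k a b ∧ ∃ v ∈ a, (v + (k : ZMod M)) ∈ b) ∨
  (∃ a1 b1 a2 b2 : ZMod M, a = s(a1, a2) ∧ b = s(b1, b2) ∧ CW [a1, b1, a2, b2] ∧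
    (∃ x : ℕ, 1 ≤ x ∧ cnt a1 b1 = x * (m + 1) + k) ∧
    (∃ x : ℕ, 1 ≤ x ∧ cnt a2 b2 = x * (m + 1) + k)) ∨
  b = shiftD k a

/-- `S` is `m`-rigid. -/
def MRigid (m : ℕ) (S : Set (Sym2 (ZMod M))) : Prop :=
  ∀ a ∈ S, ∀ b ∈ S, ∀ k : ℕ, 1 ≤ k → k ≤ m → ¬ Ek m k b a

/-- `S` is maximal `m`-rigid (among sets of `(m+1)`-diagonals). -/
def MaxMRigid (m : ℕ) (S : Set (Sym2 (ZMod M))) : Prop :=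
  (∀ d ∈ S, IsMDiag m d) ∧ MRigid m S ∧
  ∀ d : Sym2 (ZMod M), IsMDiag m d → d ∉ S → ¬ MRigid m (insert d S)

/-- `v` lies on no diagonal of `S`. -/
def Isolated (S : Set (Sym2 (ZMod M))) (v : ZMod M) : Prop := ∀ d ∈ S, v ∉ d

/-- The graph of `S`. -/
def graphOf (S : Set (Sym2 (ZMod M))) : SimpleGraph (ZMod M) := SimpleGraph.fromEdgeSet S

/-- The induced subgraph of the graph of `S` on non-isolated vertices is connected. -/
def ConnectedSet (S : Set (Sym2 (ZMod M))) : Prop :=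
  ((graphOf S).induce {v : ZMod M | ¬ Isolated S v}).Connected

/-- A tiling: a set of pairwise noncrossing diagonals. -/
def IsTiling (S : Set (Sym2 (ZMod M))) : Prop :=
  (∀ d ∈ S, ¬ d.IsDiag) ∧ ∀ d ∈ S, ∀ e ∈ S, ¬ Crosses d e

/-- The tile of `S` adjacent to the diagonal `{a,b}` on the side of the clockwise arc
from `a` to `b`. -/
def tileAt (S : Set (Sym2 (ZMod M))) (a b : ZMod M) : Set (ZMod M) :=
  {v | cnt a v ≤ cnt a b ∧
    ∀ c e : ZMod M, s(c, e) ∈ S → s(c, e) ≠ s(a, b) →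
      cnt a c ≤ cnt a e → cnt a e ≤ cnt a b →
      ¬ (cnt a c < cnt a v ∧ cnt a v < cnt a e)}

def IsTile (S : Set (Sym2 (ZMod M))) (T : Set (ZMod M)) : Prop :=
  ∃ a b : ZMod M, s(a, b) ∈ S ∧ T = tileAt S a b

/-- `d` is a bounding diagonal of the tile `T`. -/
def IsBounding (S : Set (Sym2 (ZMod M))) (T : Set (ZMod M)) (d : Sym2 (ZMod M)) : Prop :=
  d ∈ S ∧ ∀ v ∈ d, v ∈ T

/-- The length `ℓ(T)` of a tile: the number of its bounding diagonals. -/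
noncomputable def tileLen (S : Set (Sym2 (ZMod M))) (T : Set (ZMod M)) : ℕ :=
  {d | IsBounding S T d}.ncard

/-- `v` is strictly clockwise between `p` and `q`. -/
def StrictIn (p q v : ZMod M) : Prop := 1 < cnt p v ∧ cnt p v < cnt p q

/-- `(p,q)` is an open boundary of the tile `T`. -/
def IsOpenBdry (S : Set (Sym2 (ZMod M))) (T : Set (ZMod M)) (p q : ZMod M) : Prop :=
  p ≠ q ∧ p ∈ T ∧ q ∈ T ∧
  (∃ d, IsBounding S T d ∧ p ∈ d) ∧ (∃ d, IsBounding S T d ∧ q ∈ d) ∧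
  (∀ v : ZMod M, StrictIn p q v → v ∈ T ∧ Isolated S v) ∧
  (∀ d, IsBounding S T d → d ≠ s(p, q) → ∀ v ∈ d, ¬ StrictIn p q v)

def IsOpenTile (S : Set (Sym2 (ZMod M))) (T : Set (ZMod M)) : Prop :=
  ∃ p q, IsOpenBdry S T p q

/-- Tile of type `(ℓ, b)` with `b ≥ 1`. -/
def HasOpenType (S : Set (Sym2 (ZMod M))) (T : Set (ZMod M)) (l b : ℕ) : Prop :=
  tileLen S T = l ∧ ∃ p q, IsOpenBdry S T p q ∧ cnt p q - 1 = b

/-- Tile of type `(ℓ, 0)`. -/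
def HasClosedType (S : Set (Sym2 (ZMod M))) (T : Set (ZMod M)) (l : ℕ) : Prop :=
  tileLen S T = l ∧ ¬ IsOpenTile S T

/-- The list of possible tile types from Proposition 2.9. -/
def GoodTiles (m : ℕ) (S : Set (Sym2 (ZMod M))) : Prop :=
  ∀ T : Set (ZMod M), IsTile S T →
    (∃ k, 1 ≤ k ∧ k ≤ m + 1 ∧ HasOpenType S T k (m + k - 1)) ∨
    (tileLen S T = m + 2 ∧ ∃ p q, IsOpenBdry S T p q ∧ cnt p q - 1 = 2 * m + 1 ∧
      ∃ d, IsBounding S T d ∧ (p ∈ d ∨ q ∈ d) ∧ IsShort m d) ∨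
    HasOpenType S T 1 (2 * m + 1) ∨
    (tileLen S T = m + 3 ∧ ∃ p q, IsOpenBdry S T p q ∧ cnt p q - 1 = m + 1 ∧
      ∀ d, IsBounding S T d → (p ∈ d ∨ q ∈ d) → IsShort m d) ∨
    HasClosedType S T (m + 3)

/-- A quiver (arrow relation) with a set of length-two relation paths. -/
structure GPair (V : Type) where
  Arr : V → V → Prop
  Rel : V → V → V → Prop

namespace GPair

variable {V : Type} (G : GPair V)

def IsGentle : Prop :=
  (∀ x y z, G.Rel x y z → G.Arr x y ∧ G.Arr y z) ∧
  (∀ x, ¬ G.Arr x x) ∧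
  (∀ x y, G.Arr x y → ¬ G.Arr y x) ∧
  (∀ x, {y | G.Arr x y}.encard ≤ 2) ∧
  (∀ x, {y | G.Arr y x}.encard ≤ 2) ∧
  (∀ x y, G.Arr x y → {z | G.Arr y z ∧ ¬ G.Rel x y z}.encard ≤ 1) ∧
  (∀ x y, G.Arr x y → {w | G.Arr w x ∧ ¬ G.Rel w x y}.encard ≤ 1) ∧
  (∀ x y, G.Arr x y → {z | G.Arr y z ∧ G.Rel x y z}.encard ≤ 1) ∧
  (∀ x y, G.Arr x y → {w | G.Arr w x ∧ G.Rel w x y}.encard ≤ 1)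

/-- The underlying undirected graph is connected. -/
def Conn : Prop := (SimpleGraph.fromRel G.Arr).Connected

def OrientedCycle (r : ℕ) (v : ZMod r → V) : Prop :=
  3 ≤ r ∧ Function.Injective v ∧ ∀ i : ZMod r, G.Arr (v i) (v (i + 1))

def UndirCycle (r : ℕ) (v : ZMod r → V) : Prop :=
  3 ≤ r ∧ Function.Injective v ∧ ∀ i : ZMod r, G.Arr (v i) (v (i + 1)) ∨ G.Arr (v (i + 1)) (v i)

/-- All cycles are oriented and relation-full. -/
def CyclesOrientedFull : Prop :=
  (∀ (r : ℕ) (v : ZMod r → V), G.UndirCycle r v →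
    (∀ i, G.Arr (v i) (v (i + 1))) ∨ ∀ i, G.Arr (v (i + 1)) (v i)) ∧
  ∀ (r : ℕ) (v : ZMod r → V), G.OrientedCycle r v →
    ∀ i : ZMod r, G.Rel (v i) (v (i + 1)) (v (i + 2))

/-- The valency of a vertex: the number of arrows incident with it. -/
noncomputable def valency (x : V) : ℕ∞ := {y | G.Arr x y}.encard + {y | G.Arr y x}.encard

/-- A (non-trivial) permitted path, recorded by its list of vertices. -/
def PermPath (l : List V) : Prop :=
  2 ≤ l.length ∧ l.Chain' G.Arr ∧ ∀ x y z : V, [x, y, z] <:+: l → ¬ G.Rel x y z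

/-- A (non-trivial) forbidden path, recorded by its list of vertices. -/
def ForbPath (l : List V) : Prop :=
  2 ≤ l.length ∧ l.Chain' G.Arr ∧ (l.zip l.tail).Nodup ∧
    ∀ x y z : V, [x, y, z] <:+: l → G.Rel x y z

def TrivPermVtx (v : V) : Prop :=
  {y | G.Arr v y}.Subsingleton ∧ {y | G.Arr y v}.Subsingleton ∧
  ∀ x y, G.Arr x v → G.Arr v y → ¬ G.Rel x v y

def TrivForbVtx (v : V) : Prop :=
  {y | G.Arr v y}.Subsingleton ∧ {y | G.Arr y v}.Subsingleton ∧
  ∀ x y, G.Arr x v → G.Arr v y → G.Rel x v y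

/-- A permitted thread: a maximal permitted path, or a trivial permitted thread `[v]`. -/
def PermThread (l : List V) : Prop :=
  (G.PermPath l ∧ (∀ w, ¬ G.PermPath (l ++ [w])) ∧ ∀ w, ¬ G.PermPath (w :: l)) ∨
  ∃ v, l = [v] ∧ G.TrivPermVtx v

/-- A forbidden thread: a maximal forbidden path, or a trivial forbidden thread `[v]`. -/
def ForbThread (l : List V) : Prop :=
  (G.ForbPath l ∧ (∀ w, ¬ G.ForbPath (l ++ [w])) ∧ ∀ w, ¬ G.ForbPath (w :: l)) ∨
  ∃ v, l = [v] ∧ G.TrivForbVtx v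

end GPair

/-- A thread is closed if it is a cycle. -/
def IsClosedList {V : Type} (l : List V) : Prop := 2 ≤ l.length ∧ l.head? = l.getLast?

/-- The length (number of arrows) of a thread. -/
def threadLen {V : Type} (l : List V) : ℕ := l.length - 1

/-- Number of occurrences of the vertex `v` along the thread `l`. -/
def occ {V : Type} [DecidableEq V] (l : List V) (v : V) : ℕ :=
  if 2 ≤ l.length ∧ l.head? = l.getLast? then l.dropLast.count v else l.count v

/-- Arrow of the tiling quiver arising from the tile `T`. -/
def QArrIn (S : Set (Sym2 (ZMod M))) (T : Set (ZMod M)) (α β : Sym2 (ZMod M)) : Prop :=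
  IsTile S T ∧ IsBounding S T α ∧ IsBounding S T β ∧
  ∃ x a b : ZMod M, α = s(x, a) ∧ β = s(x, b) ∧ cnt x a < cnt x b

def QArr (S : Set (Sym2 (ZMod M))) (α β : Sym2 (ZMod M)) : Prop := ∃ T, QArrIn S T α β

def QRel (S : Set (Sym2 (ZMod M))) (α β γ : Sym2 (ZMod M)) : Prop :=
  ∃ T, QArrIn S T α β ∧ QArrIn S T β γ

/-- The tiling-algebra pair `(Q_S, R_S)` of a tiling `S`. -/
def tilingPair (S : Set (Sym2 (ZMod M))) : GPair {d : Sym2 (ZMod M) // d ∈ S} where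
  Arr := fun α β => QArr S α.1 β.1
  Rel := fun α β γ => QRel S α.1 β.1 γ.1

/-- Isomorphism of pairs. -/
def GPair.Iso {V W : Type} (G : GPair V) (H : GPair W) : Prop :=
  ∃ e : V ≃ W, (∀ x y, G.Arr x y ↔ H.Arr (e x) (e y)) ∧
    ∀ x y z, G.Rel x y z ↔ H.Rel (e x) (e y) (e z)

/-- `l` is the fan at the marked point `v`: the list of all diagonals of `S` incident with
`v`, in clockwise order around `v`. -/
def IsFan (S : Set (Sym2 (ZMod M))) (v : ZMod M) (l : List {d : Sym2 (ZMod M) // d ∈ S}) :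
    Prop :=
  l.Nodup ∧ (∀ d : {d : Sym2 (ZMod M) // d ∈ S}, d ∈ l ↔ v ∈ d.1) ∧
  l.Pairwise fun d e => ∃ a b : ZMod M, d.1 = s(v, a) ∧ e.1 = s(v, b) ∧ cnt v a < cnt v b

/-- `F` is the forbidden thread ending at `t(H)` from the opposite direction to `H`. -/
def OppEnd {V : Type} (G : GPair V) (H F : List V) : Prop :=
  ∃ y : V, H.getLast? = some y ∧ F.getLast? = some y ∧
    ((∃ x w, [x, y] <:+ H ∧ [w, y] <:+ F ∧ x ≠ w) ∨
     (∃ w, [w, y] <:+ F ∧ (∀ u, G.Arr u y → u = w) ∧ ¬ ([w, y] <:+: H)) ∨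
     (F = [y] ∧ {u | G.Arr u y}.Subsingleton ∧ ∀ u, G.Arr u y → [u, y] <:+: H))

/-- `H` is the permitted thread starting at `s(F)` in the opposite direction to `F`. -/
def OppStart {V : Type} (G : GPair V) (F H : List V) : Prop :=
  ∃ y : V, F.head? = some y ∧ H.head? = some y ∧
    ((∃ x w, [y, x] <+: F ∧ [y, w] <+: H ∧ x ≠ w) ∨
     (∃ w, [y, w] <+: H ∧ (∀ u, G.Arr y u → u = w) ∧ ¬ ([y, w] <:+: F)) ∨
     (H = [y] ∧ {u | G.Arr y u}.Subsingleton ∧ ∀ u, G.Arr y u → [y, u] <:+: F))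

/-- The AG-successor relation on permitted threads. -/
def AGStep {V : Type} (G : GPair V) (H H' : List V) : Prop :=
  ∃ F, G.ForbThread F ∧ OppEnd G H F ∧ OppStart G F H'

/-- The sides of a tile: bounding diagonals together with boundary edges. -/
def sides (S : Set (Sym2 (ZMod M))) (T : Set (ZMod M)) : Set (Sym2 (ZMod M)) :=
  {d | IsBounding S T d} ∪ {d | ∃ v : ZMod M, d = s(v, v + 1) ∧ v ∈ T ∧ (v + 1) ∈ T}

/-- An `(m+3)`-angulation of a disc. -/
def IsAngulation (m : ℕ) (S : Set (Sym2 (ZMod M))) : Prop :=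
  IsTiling S ∧ (∀ v : ZMod M, s(v, v + 1) ∉ S) ∧
  ∀ T, IsTile S T → (sides S T).ncard = m + 3

section Key
variable {P K : Type*} [LinearOrder K]

/-- Clockwise from `x`, the point `a` is met strictly before `b`. -/
def L (k : P → K) (x a b : P) : Prop :=
  (k x ≤ k a ∧ k a < k b) ∨ (k a < k b ∧ k b < k x) ∨ (k b < k x ∧ k x ≤ k a)

def Cyc4 (k : P → K) (a b c d : P) : Prop := a ≠ b ∧ L k a b c ∧ L k a c d

structure NC (k : P → K) (S : Set (Sym2 P)) : Prop where
  nd : ∀ a, s(a, a) ∉ S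
  nc : ∀ a b c d, s(a, c) ∈ S → s(b, d) ∈ S → ¬ Cyc4 k a b c d

/-- Consecutive in the fan at `x`. -/
def Consec (k : P → K) (S : Set (Sym2 P)) (x a b : P) : Prop :=
  s(x, a) ∈ S ∧ s(x, b) ∈ S ∧ L k x a b ∧ ∀ c, s(x, c) ∈ S → ¬ (L k x a c ∧ L k x c b)

def FA (k : P → K) (S : Set (Sym2 P)) (α β : Sym2 P) : Prop :=
  ∃ x a b, α = s(x, a) ∧ β = s(x, b) ∧ Consec k S x a b

def FR (k : P → K) (S : Set (Sym2 P)) (α β γ : Sym2 P) : Prop :=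
  ∃ x y a c, α = s(x, a) ∧ β = s(x, y) ∧ γ = s(y, c) ∧ Consec k S x a y ∧ Consec k S y x c

end Key

section Bridge
variable {M : ℕ}

def kp (p v : ZMod M) : ℕ := (v - p).val

lemma kp_inj [NeZero M] (p : ZMod M) : Function.Injective (kp p) := by
  intro a b h
  have := ZMod.val_injective M h
  simpa using this

lemma kp_self (p : ZMod M) : kp p p = 0 := by simp [kp]

lemma val_sub_ite [NeZero M] (p a b : ZMod M) :
    (b - a).val = if kp p a ≤ kp p b then kp p b - kp p a else kp p b + M - kp p a := by
  have e : b - a = (b - p) - (a - p) := by ring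
  rw [e]
  split_ifs with h
  · exact ZMod.val_sub h
  · have h' : kp p b ≤ kp p a := by omega
    have h2 : ((a - p) - (b - p)).val = kp p a - kp p b := ZMod.val_sub h'
    have h3 : (a - p) - (b - p) ≠ 0 := by
      intro h0
      rw [h0] at h2
      simp at h2
      omega
    haveI : NeZero ((a - p) - (b - p)) := ⟨h3⟩
    have h4 := ZMod.val_neg_of_ne_zero ((a - p) - (b - p))
    rw [neg_sub] at h4
    rw [h4, h2]
    have : kp p a < M := ZMod.val_lt _
    omega

lemma cnt_lt_iff [NeZero M] (p x a b : ZMod M) : cnt x a < cnt x b ↔ L (kp p) x a b := by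
  have h1 : kp p a < M := ZMod.val_lt _
  have h2 : kp p b < M := ZMod.val_lt _
  have h3 : kp p x < M := ZMod.val_lt _
  unfold cnt L
  rw [val_sub_ite p x a, val_sub_ite p x b]
  split_ifs <;> omega

lemma CW_iff [NeZero M] (p a b c d : ZMod M) : CW [a, b, c, d] ↔ Cyc4 (kp p) a b c d := by
  have h1 : kp p a < M := ZMod.val_lt _
  have h2 : kp p b < M := ZMod.val_lt _
  have h3 : kp p c < M := ZMod.val_lt _
  have h4 : kp p d < M := ZMod.val_lt _
  have i := fun u v => (kp_inj p).eq_iff (a := u) (b := v)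
  have e1 : (a = b) = (kp p a = kp p b) := by rw [i]
  have e2 : (a = c) = (kp p a = kp p c) := by rw [i]
  have e3 : (a = d) = (kp p a = kp p d) := by rw [i]
  have e4 : (b = c) = (kp p b = kp p c) := by rw [i]
  have e5 : (b = d) = (kp p b = kp p d) := by rw [i]
  have e6 : (c = d) = (kp p c = kp p d) := by rw [i]
  simp [CW, Cyc4, L, val_sub_ite p, e1, e2, e3, e4, e5, e6, -ZMod.natCast_val]
  split_ifs <;> omega

/-- L does not depend on the base point. -/
lemma L_base [NeZero M] (p q x a b : ZMod M) : L (kp p) x a b ↔ L (kp q) x a b := by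
  rw [← cnt_lt_iff, ← cnt_lt_iff]

lemma Cyc4_base [NeZero M] (p q a b c d : ZMod M) :
    Cyc4 (kp p) a b c d ↔ Cyc4 (kp q) a b c d := by
  rw [← CW_iff, ← CW_iff]

lemma tiling_NC [NeZero M] (p : ZMod M) (S : Set (Sym2 (ZMod M))) : IsTiling S ↔ NC (kp p) S := by
  constructor
  · rintro ⟨h1, h2⟩
    refine ⟨fun a ha => h1 _ ha (by simp), fun a b c d h h' hc => ?_⟩
    exact h2 _ h _ h' ⟨a, b, c, d, rfl, rfl, (CW_iff p _ _ _ _).2 hc⟩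
  · rintro ⟨h1, h2⟩
    refine ⟨fun d hd hd' => ?_, ?_⟩
    · induction d with | _ a b =>
      simp at hd'
      subst hd'
      exact h1 _ hd
    · rintro d hd e he ⟨a, b, c, d', rfl, rfl, h⟩
      exact h2 _ _ _ _ hd he ((CW_iff p _ _ _ _).1 h)

lemma Consec_base [NeZero M] (p q : ZMod M) (S : Set (Sym2 (ZMod M))) (x a b : ZMod M) :
    Consec (kp p) S x a b ↔ Consec (kp q) S x a b := by
  unfold Consec
  simp only [L_base p q]

lemma FA_base [NeZero M] (p q : ZMod M) (S : Set (Sym2 (ZMod M))) (α β : Sym2 (ZMod M)) :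
    FA (kp p) S α β ↔ FA (kp q) S α β := by
  unfold FA
  simp only [Consec_base p q]

lemma le_of_tile [NeZero M] {S : Set (Sym2 (ZMod M))} {p q v : ZMod M} (h : v ∈ tileAt S p q) :
    kp p v ≤ kp p q := by
  have := h.1; unfold cnt at this; unfold kp; omega

lemma tile_iff [NeZero M] {S : Set (Sym2 (ZMod M))} {p q v : ZMod M} : v ∈ tileAt S p q ↔
    kp p v ≤ kp p q ∧ ∀ c e : ZMod M, s(c, e) ∈ S → s(c, e) ≠ s(p, q) →
      kp p c ≤ kp p e → kp p e ≤ kp p q → ¬ (kp p c < kp p v ∧ kp p v < kp p e) := by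
  simp [tileAt, cnt, kp]

/-- No diagonal of `S` at `x` separates two points of a tile containing `x`. -/
lemma tile_nosep [NeZero M] {S : Set (Sym2 (ZMod M))} {p q : ZMod M} (hS : NC (kp p) S)
    (hpq : s(p, q) ∈ S) {x a b c : ZMod M} (hx : x ∈ tileAt S p q) (ha : a ∈ tileAt S p q)
    (hb : b ∈ tileAt S p q) (hxa : x ≠ a) (hc : s(x, c) ∈ S) :
    ¬ (L (kp p) x a c ∧ L (kp p) x c b) := by
  rintro ⟨h1, h2⟩
  have hp0 := kp_self p
  have i := fun u v => (kp_inj p).eq_iff (a := u) (b := v)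
  obtain ⟨hxq, -⟩ := tile_iff.1 hx
  obtain ⟨haq, ha'⟩ := tile_iff.1 ha
  obtain ⟨hbq, hb'⟩ := tile_iff.1 hb
  have hxa' : kp p x ≠ kp p a := by rwa [Ne, i]
  have hc' : s(c, x) ∈ S := by rwa [Sym2.eq_swap]
  have hcx : kp p c ≠ kp p x := by
    rw [Ne, i]; rintro rfl; exact hS.nd _ hc
  have A1 := ha' x c hc
  have A2 := ha' c x hc'
  have B1 := hb' x c hc
  have B2 := hb' c x hc'
  have N1 := hS.nc p x q c hpq hc
  have N2 := hS.nc p c q x hpq hc'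
  by_cases hne : s(x, c) = s(p, q)
  · rw [Sym2.eq_iff] at hne
    rcases hne with ⟨rfl, rfl⟩ | ⟨rfl, rfl⟩ <;> unfold L at h1 h2 <;> omega
  · have hne' : s(c, x) ≠ s(p, q) := by rwa [Sym2.eq_swap]
    simp only [Cyc4, L, Ne, ← i] at *
    simp only [hne, hne', not_false_eq_true, true_imp_iff] at A1 A2 B1 B2
    omega

lemma Consec_tile_snd [NeZero M] (p : ZMod M) {S : Set (Sym2 (ZMod M))} (hS : NC (kp p) S)
    {x a b : ZMod M} (h : Consec (kp p) S x a b) : b ∈ tileAt S a x := by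
  rw [Consec_base p a] at h
  have hS : NC (kp a) S := (tiling_NC a S).1 ((tiling_NC p S).2 hS)
  obtain ⟨h1, h2, h3, h4⟩ := h
  have hp0 := kp_self a
  have i := fun u v => (kp_inj a).eq_iff (a := u) (b := v)
  have nax : kp a a ≠ kp a x := by rw [Ne, i]; rintro rfl; exact hS.nd _ h1
  have nbx : kp a b ≠ kp a x := by rw [Ne, i]; rintro rfl; exact hS.nd _ h2
  rw [tile_iff]
  refine ⟨by unfold L at h3; omega, fun c e hce hne h5 h6 ⟨h7, h8⟩ => ?_⟩
  by_cases hex : e = x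
  · subst hex
    have hca : c ≠ a := by rintro rfl; exact hne rfl
    rw [Ne, ← i] at hca
    refine h4 c (by rwa [Sym2.eq_swap]) ⟨?_, ?_⟩ <;> unfold L at * <;> omega
  · rw [← i] at hex
    apply hS.nc c b e x hce (by rwa [Sym2.eq_swap])
    refine ⟨?_, ?_, ?_⟩
    · rw [Ne, ← i]; omega
    all_goals unfold L at *; omega

lemma Consec_tile_fst [NeZero M] (p : ZMod M) {S : Set (Sym2 (ZMod M))} (hS : NC (kp p) S)
    {x a b : ZMod M} (h : Consec (kp p) S x a b) : a ∈ tileAt S x b := by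
  rw [Consec_base p x] at h
  have hS : NC (kp x) S := (tiling_NC x S).1 ((tiling_NC p S).2 hS)
  obtain ⟨h1, h2, h3, h4⟩ := h
  have hp0 := kp_self x
  have i := fun u v => (kp_inj x).eq_iff (a := u) (b := v)
  have nax : kp x a ≠ kp x x := by rw [Ne, i]; rintro rfl; exact hS.nd _ h1
  have nbx : kp x b ≠ kp x x := by rw [Ne, i]; rintro rfl; exact hS.nd _ h2
  rw [tile_iff]
  refine ⟨by unfold L at h3; omega, fun c e hce hne h5 h6 ⟨h7, h8⟩ => ?_⟩
  by_cases hex : c = x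
  · subst hex
    have hca : e ≠ b := by rintro rfl; exact hne rfl
    rw [Ne, ← i] at hca
    refine h4 e hce ⟨?_, ?_⟩ <;> unfold L at * <;> omega
  · rw [← i] at hex
    apply hS.nc x c a e h1 hce
    refine ⟨?_, ?_, ?_⟩
    · rw [Ne, ← i]; omega
    all_goals unfold L at *; omega

lemma fst_tile [NeZero M] {S : Set (Sym2 (ZMod M))} (a b : ZMod M) : a ∈ tileAt S a b := by
  rw [tile_iff, kp_self]; refine ⟨by omega, fun c e _ _ _ _ => by omega⟩

lemma snd_tile [NeZero M] {S : Set (Sym2 (ZMod M))} (a b : ZMod M) : b ∈ tileAt S a b := by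
  rw [tile_iff]; refine ⟨by omega, fun c e _ _ _ _ => by omega⟩

lemma bdg [NeZero M] {S : Set (Sym2 (ZMod M))} {T : Set (ZMod M)} {a b : ZMod M} :
    IsBounding S T s(a, b) ↔ s(a, b) ∈ S ∧ a ∈ T ∧ b ∈ T := by
  simp [IsBounding]

lemma QArrIn_Consec [NeZero M] (p : ZMod M) {S : Set (Sym2 (ZMod M))} (hS : NC (kp p) S)
    {T : Set (ZMod M)} {x a b : ZMod M} (hT : IsTile S T) (ha : IsBounding S T s(x, a))
    (hb : IsBounding S T s(x, b)) {c : ZMod M} (hc : s(x, c) ∈ S) :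
    ¬ (L (kp p) x a c ∧ L (kp p) x c b) := by
  obtain ⟨p', q, hpq, rfl⟩ := hT
  rw [bdg] at ha hb
  rw [L_base p p', L_base p p']
  refine tile_nosep ((tiling_NC p' S).1 ((tiling_NC p S).2 hS)) hpq ha.2.1 ha.2.2 hb.2.2 ?_ hc
  rintro rfl; exact hS.nd _ ha.1

lemma QArr_iff [NeZero M] (p : ZMod M) {S : Set (Sym2 (ZMod M))} (hS : NC (kp p) S)
    (α β : Sym2 (ZMod M)) : QArr S α β ↔ FA (kp p) S α β := by
  constructor
  · rintro ⟨T, hT, hα, hβ, x, a, b, rfl, rfl, hlt⟩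
    exact ⟨x, a, b, rfl, rfl, hα.1, hβ.1, (cnt_lt_iff p _ _ _).1 hlt,
      fun c hc => QArrIn_Consec p hS hT hα hβ hc⟩
  · rintro ⟨x, a, b, rfl, rfl, h⟩
    refine ⟨tileAt S a x, ⟨a, x, by rw [Sym2.eq_swap]; exact h.1, rfl⟩,
      bdg.2 ⟨h.1, snd_tile _ _, fst_tile _ _⟩, bdg.2 ⟨h.2.1, snd_tile _ _, Consec_tile_snd p hS h⟩,
      x, a, b, rfl, rfl, (cnt_lt_iff p _ _ _).2 h.2.2.1⟩

lemma QRel_iff [NeZero M] (p : ZMod M) {S : Set (Sym2 (ZMod M))} (hS : NC (kp p) S)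
    (α β γ : Sym2 (ZMod M)) : QRel S α β γ ↔ FR (kp p) S α β γ := by
  constructor
  · rintro ⟨T, ⟨hT, hα, hβ, x, a, y, rfl, rfl, hlt⟩, -, -, hγ, x', b', c, hx', rfl, hlt'⟩
    rw [Sym2.eq_iff] at hx'
    rcases hx' with ⟨rfl, rfl⟩ | ⟨rfl, rfl⟩
    · exact absurd ⟨(cnt_lt_iff p _ _ _).1 hlt, (cnt_lt_iff p _ _ _).1 hlt'⟩
        (QArrIn_Consec p hS hT hα hγ hβ.1)
    · have hβ' := hβ
      rw [Sym2.eq_swap] at hβ'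
      exact ⟨x, y, a, c, rfl, rfl, rfl,
        ⟨hα.1, hβ.1, (cnt_lt_iff p _ _ _).1 hlt, fun c hc => QArrIn_Consec p hS hT hα hβ hc⟩,
        hβ'.1, hγ.1, (cnt_lt_iff p _ _ _).1 hlt', fun c hc => QArrIn_Consec p hS hT hβ' hγ hc⟩
  · rintro ⟨x, y, a, c, rfl, rfl, rfl, h, h'⟩
    have hT : IsTile S (tileAt S x y) := ⟨x, y, h.2.1, rfl⟩
    have hβ : IsBounding S (tileAt S x y) s(x, y) := bdg.2 ⟨h.2.1, fst_tile _ _, snd_tile _ _⟩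
    refine ⟨tileAt S x y, ⟨hT, bdg.2 ⟨h.1, fst_tile _ _, Consec_tile_fst p hS h⟩, hβ,
      x, a, y, rfl, rfl, (cnt_lt_iff p _ _ _).2 h.2.2.1⟩, hT, hβ,
      bdg.2 ⟨h'.2.1, snd_tile _ _, Consec_tile_snd p hS h'⟩, y, x, c, Sym2.eq_swap, rfl,
      (cnt_lt_iff p _ _ _).2 h'.2.2.1⟩

end Bridge

section Fan
variable {P K : Type*} [LinearOrder K] {k : P → K} {S : Set (Sym2 P)}

lemma L_irr {x a : P} : ¬ L k x a a := by unfold L; grind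
lemma L_trans {x a b c : P} (h : L k x a b) (h' : L k x b c) : L k x a c := by
  unfold L at *; grind
lemma L_asymm {x a b : P} (h : L k x a b) (h' : L k x b a) : False := L_irr (L_trans h h')
lemma L_total (hk : Function.Injective k) (x : P) {a b : P} (h : a ≠ b) :
    L k x a b ∨ L k x b a := by
  have : k a ≠ k b := fun e => h (hk e)
  unfold L; grind
/-- Rotation of the base point. -/
lemma L_rot (hk : Function.Injective k) {x a b : P} (h : L k x a b) (hx : a ≠ x) : L k a b x := by
  have : k a ≠ k x := fun e => hx (hk e)
  unfold L at *; grind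
lemma L_rot' (hk : Function.Injective k) {x a b : P} (h : L k x a b) (hx : a ≠ x) : L k b x a := by
  have : k a ≠ k x := fun e => hx (hk e)
  unfold L at *; grind
lemma L_ne_right {x a b : P} (h : L k x a b) : b ≠ x := by
  rintro rfl; unfold L at *; grind
lemma L_base_ne {x a : P} (hk : Function.Injective k) (hx : a ≠ x) : L k x x a := by
  have : k a ≠ k x := fun e => hx (hk e)
  unfold L at *; grind

lemma Consec.uniq_right (hk : Function.Injective k) {x a b b' : P} (h : Consec k S x a b)
    (h' : Consec k S x a b') : b = b' := by
  by_contra hne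
  rcases L_total hk x hne with h1 | h1
  · exact h'.2.2.2 b h.2.1 ⟨h.2.2.1, h1⟩
  · exact h.2.2.2 b' h'.2.1 ⟨h'.2.2.1, h1⟩

lemma Consec.uniq_left (hk : Function.Injective k) {x a a' b : P} (h : Consec k S x a b)
    (h' : Consec k S x a' b) : a = a' := by
  by_contra hne
  rcases L_total hk x hne with h1 | h1
  · exact h.2.2.2 a' h'.1 ⟨h1, h'.2.2.1⟩
  · exact h'.2.2.2 a h.1 ⟨h1, h.2.2.1⟩

lemma FA_left {p q : P} {γ : Sym2 P} : FA k S s(p, q) γ ↔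
    (∃ c, γ = s(p, c) ∧ Consec k S p q c) ∨ (∃ c, γ = s(q, c) ∧ Consec k S q p c) := by
  constructor
  · rintro ⟨x, a, b, h, rfl, hc⟩
    rw [Sym2.eq_iff] at h
    rcases h with ⟨rfl, rfl⟩ | ⟨rfl, rfl⟩
    · exact Or.inl ⟨_, rfl, hc⟩
    · exact Or.inr ⟨_, rfl, hc⟩
  · rintro (⟨c, rfl, h⟩ | ⟨c, rfl, h⟩)
    · exact ⟨_, _, _, rfl, rfl, h⟩
    · exact ⟨_, _, _, Sym2.eq_swap, rfl, h⟩

lemma FA_right {p q : P} {γ : Sym2 P} : FA k S γ s(p, q) ↔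
    (∃ c, γ = s(p, c) ∧ Consec k S p c q) ∨ (∃ c, γ = s(q, c) ∧ Consec k S q c p) := by
  constructor
  · rintro ⟨x, a, b, rfl, h, hc⟩
    rw [Sym2.eq_iff] at h
    rcases h with ⟨rfl, rfl⟩ | ⟨rfl, rfl⟩
    · exact Or.inl ⟨_, rfl, hc⟩
    · exact Or.inr ⟨_, rfl, hc⟩
  · rintro (⟨c, rfl, h⟩ | ⟨c, rfl, h⟩)
    · exact ⟨_, _, _, rfl, rfl, h⟩
    · exact ⟨_, _, _, rfl, Sym2.eq_swap, h⟩

/-- Two chords both meeting at `x`, with the other ends `a ≠ b`, have only `x` in common. -/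
lemma chord_meet {x a b y c d : P} (hab : a ≠ b) (h1 : s(x, a) = s(y, c)) (h2 : s(x, b) = s(y, d)) :
    y = x ∧ c = a ∧ d = b := by
  rw [Sym2.eq_iff] at h1 h2
  grind

lemma Consec.ne {x a b : P} (h : Consec k S x a b) : a ≠ b := by
  rintro rfl; exact L_irr h.2.2.1

lemma FA_iff_of {x a b : P} (h : a ≠ b) : FA k S s(x, a) s(x, b) ↔ Consec k S x a b := by
  constructor
  · rintro ⟨y, c, d, h1, h2, h3⟩
    obtain ⟨rfl, rfl, rfl⟩ := chord_meet h h1 h2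
    exact h3
  · exact fun h => ⟨_, _, _, rfl, rfl, h⟩

lemma FA_irr (α : Sym2 P) : ¬ FA k S α α := by
  rintro ⟨x, a, b, rfl, h, h3⟩
  exact h3.ne (Sym2.congr_right.1 h)

lemma FA_asymm {α β : Sym2 P} (h : FA k S α β) : ¬ FA k S β α := by
  obtain ⟨x, a, b, rfl, rfl, h⟩ := h
  rw [FA_iff_of h.ne.symm]
  exact fun h' => L_asymm h.2.2.1 h'.2.2.1

/-- relation for three chords given two arrows. -/
lemma FR_iff {x a y : P} {γ : Sym2 P} (h : Consec k S x a y) :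
    FR k S s(x, a) s(x, y) γ ↔ ∃ c, γ = s(y, c) ∧ Consec k S y x c := by
  constructor
  · rintro ⟨x', y', a', c, h1, h2, rfl, h3, h4⟩
    obtain ⟨rfl, rfl, rfl⟩ := chord_meet h.ne h1 h2
    exact ⟨c, rfl, h4⟩
  · rintro ⟨c, rfl, h'⟩
    exact ⟨x, y, a, c, rfl, rfl, rfl, h, h'⟩

lemma FR_FA {α β γ : Sym2 P} (h : FR k S α β γ) : FA k S α β ∧ FA k S β γ := by
  obtain ⟨x, y, a, c, rfl, rfl, rfl, h, h'⟩ := h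
  exact ⟨⟨_, _, _, rfl, rfl, h⟩, ⟨_, _, _, Sym2.eq_swap, rfl, h'⟩⟩

lemma FR_iff' (nd : ∀ a, s(a, a) ∉ S) {x a y : P} {α : Sym2 P} (h : Consec k S y x a) :
    FR k S α s(x, y) s(y, a) ↔ ∃ c, α = s(x, c) ∧ Consec k S x c y := by
  constructor
  · rintro ⟨x', y', a', c, rfl, h2, h3, h4, h5⟩
    have h6 := h.ne
    rw [Sym2.eq_iff] at h2 h3
    have hne : x ≠ y := by
      rintro rfl; exact nd _ h.1
    have : x' = x ∧ y' = y := by grind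
    obtain ⟨rfl, rfl⟩ := this
    exact ⟨_, rfl, h4⟩
  · rintro ⟨c, rfl, h'⟩
    exact ⟨_, _, _, _, rfl, rfl, rfl, h', h⟩

end Fan

/-- Elementary form of gentleness. -/
structure EG {V : Type} (G : GPair V) : Prop where
  rel : ∀ {x y z}, G.Rel x y z → G.Arr x y ∧ G.Arr y z
  irr : ∀ x, ¬ G.Arr x x
  asym : ∀ {x y}, G.Arr x y → ¬ G.Arr y x
  out2 : ∀ {x a b c}, G.Arr x a → G.Arr x b → G.Arr x c → a = b ∨ a = c ∨ b = c
  in2 : ∀ {x a b c}, G.Arr a x → G.Arr b x → G.Arr c x → a = b ∨ a = c ∨ b = c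
  nro : ∀ {x y z z'}, G.Arr x y → G.Arr y z → ¬ G.Rel x y z → G.Arr y z' → ¬ G.Rel x y z' → z = z'
  nri : ∀ {x y z z'}, G.Arr x y → G.Arr z x → ¬ G.Rel z x y → G.Arr z' x → ¬ G.Rel z' x y → z = z'
  ro : ∀ {x y z z'}, G.Rel x y z → G.Rel x y z' → z = z'
  ri : ∀ {x y z z'}, G.Rel z x y → G.Rel z' x y → z = z'

lemma encard_le_two {α : Type*} (s : Set α) :
    s.encard ≤ 2 ↔ ∀ a ∈ s, ∀ b ∈ s, ∀ c ∈ s, a = b ∨ a = c ∨ b = c := by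
  constructor
  · intro h a ha b hb c hc
    by_contra! hh
    have h3 : ({a, b, c} : Set α).encard = 3 :=
      Set.encard_eq_three.2 ⟨a, b, c, hh.1, hh.2.1, hh.2.2, rfl⟩
    have h4 : ({a, b, c} : Set α).encard ≤ s.encard := Set.encard_le_encard (by
      rintro x (rfl | rfl | rfl) <;> assumption)
    rw [h3] at h4
    exact absurd (h4.trans h) (by decide)
  · intro h
    by_contra hlt
    have h3 : (3 : ℕ∞) ≤ s.encard := by
      have := Order.add_one_le_of_lt (not_le.1 hlt)
      exact le_trans (by decide) this
    obtain ⟨t, hts, ht⟩ := Set.exists_subset_encard_eq h3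
    obtain ⟨a, b, c, h1, h2, h3, rfl⟩ := Set.encard_eq_three.1 ht
    have := h a (hts (by simp)) b (hts (by simp)) c (hts (by simp))
    tauto

lemma encard_le_one {α : Type*} (s : Set α) :
    s.encard ≤ 1 ↔ ∀ a ∈ s, ∀ b ∈ s, a = b := by
  rw [Set.encard_le_one_iff]
  exact ⟨fun h a ha b hb => h a b ha hb, fun h a b ha hb => h a ha b hb⟩

lemma gentle_iff {V : Type} (G : GPair V) : G.IsGentle ↔ EG G := by
  unfold GPair.IsGentle
  simp only [encard_le_two, encard_le_one, Set.mem_ofPred_eq]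
  constructor
  · rintro ⟨h1, h2, h3, h4, h5, h6, h7, h8, h9⟩
    refine ⟨fun h => h1 _ _ _ h, h2, fun h => h3 _ _ h, fun h h' h'' => h4 _ _ h _ h' _ h'',
      fun h h' h'' => h5 _ _ h _ h' _ h'', fun a b c d e => h6 _ _ a _ ⟨b, c⟩ _ ⟨d, e⟩,
      fun a b c d e => h7 _ _ a _ ⟨b, c⟩ _ ⟨d, e⟩, fun a b => ?_, fun a b => ?_⟩
    · exact h8 _ _ (h1 _ _ _ a).1 _ ⟨(h1 _ _ _ a).2, a⟩ _ ⟨(h1 _ _ _ b).2, b⟩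
    · exact h9 _ _ (h1 _ _ _ a).2 _ ⟨(h1 _ _ _ a).1, a⟩ _ ⟨(h1 _ _ _ b).1, b⟩
  · intro h
    exact ⟨fun _ _ _ h' => h.rel h', h.irr, fun _ _ h' => h.asym h',
      fun _ _ h1 _ h2 _ h3 => h.out2 h1 h2 h3, fun _ _ h1 _ h2 _ h3 => h.in2 h1 h2 h3,
      fun _ _ a _ b _ c => h.nro a b.1 b.2 c.1 c.2, fun _ _ a _ b _ c => h.nri a b.1 b.2 c.1 c.2,
      fun _ _ _ _ a _ b => h.ro a.2 b.2, fun _ _ _ _ a _ b => h.ri a.2 b.2⟩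

section FanPair
variable {P K : Type} [LinearOrder K] {k : P → K} {S : Set (Sym2 P)}

def fanPair (k : P → K) (S : Set (Sym2 P)) : GPair (Sym2 P) := ⟨FA k S, FR k S⟩

lemma fan_EG (hk : Function.Injective k) (nd : ∀ a, s(a, a) ∉ S) : EG (fanPair k S) where
  rel h := FR_FA h
  irr := FA_irr
  asym h := FA_asymm h
  out2 {x a b c} h1 h2 h3 := by
    induction x with | _ p q =>
    simp only [fanPair, FA_left] at h1 h2 h3
    rcases h1 with ⟨_, rfl, h1⟩ | ⟨_, rfl, h1⟩ <;> rcases h2 with ⟨_, rfl, h2⟩ | ⟨_, rfl, h2⟩ <;>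
    rcases h3 with ⟨_, rfl, h3⟩ | ⟨_, rfl, h3⟩ <;>
    first
    | (left; rw [h1.uniq_right hk h2]; done)
    | (right; left; rw [h1.uniq_right hk h3]; done)
    | (right; right; rw [h2.uniq_right hk h3]; done)
  in2 {x a b c} h1 h2 h3 := by
    induction x with | _ p q =>
    simp only [fanPair, FA_right] at h1 h2 h3
    rcases h1 with ⟨_, rfl, h1⟩ | ⟨_, rfl, h1⟩ <;> rcases h2 with ⟨_, rfl, h2⟩ | ⟨_, rfl, h2⟩ <;>
    rcases h3 with ⟨_, rfl, h3⟩ | ⟨_, rfl, h3⟩ <;>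
    first
    | (left; rw [h1.uniq_left hk h2]; done)
    | (right; left; rw [h1.uniq_left hk h3]; done)
    | (right; right; rw [h2.uniq_left hk h3]; done)
  nro {x y z z'} h h1 n1 h2 n2 := by
    obtain ⟨p, a, q, rfl, rfl, h⟩ := h
    simp only [fanPair, FA_left, FR_iff h] at h1 n1 h2 n2
    obtain ⟨c, rfl, h3⟩ := h1.resolve_right n1
    obtain ⟨c', rfl, h4⟩ := h2.resolve_right n2
    rw [h3.uniq_right hk h4]
  nri {x y z z'} h h1 n1 h2 n2 := by
    obtain ⟨p, a, q, rfl, rfl, h⟩ := h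
    rw [Sym2.eq_swap (a := p) (b := a)] at h1 n1 h2 n2
    simp only [fanPair, FA_right, FR_iff' nd h] at h1 n1 h2 n2
    obtain ⟨c, rfl, h3⟩ := h1.resolve_left n1
    obtain ⟨c', rfl, h4⟩ := h2.resolve_left n2
    rw [h3.uniq_left hk h4]
  ro {x y z z'} h h' := by
    obtain ⟨x, y, a, c, rfl, rfl, rfl, h1, h2⟩ := h
    simp only [fanPair, FR_iff h1] at h'
    obtain ⟨c', rfl, h3⟩ := h'
    rw [h2.uniq_right hk h3]
  ri {x y z z'} h h' := by
    obtain ⟨x, y, a, c, rfl, rfl, rfl, h1, h2⟩ := h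
    simp only [fanPair, FR_iff' nd h2] at h'
    obtain ⟨c', rfl, h3⟩ := h'
    rw [h1.uniq_left hk h3]

/-- `d` lies on the side of the clockwise arc from `p` to `q`. -/
def OnSide (k : P → K) (p q : P) (d : Sym2 P) : Prop := ∀ v ∈ d, ¬ L k p q v

lemma side_or (hk : Function.Injective k) (hS : NC k S) {p q : P} (h : s(p, q) ∈ S) {d : Sym2 P}
    (hd : d ∈ S) : OnSide k p q d ∨ OnSide k q p d := by
  induction d with | _ c e =>
  have hpq : p ≠ q := by rintro rfl; exact hS.nd _ h
  have N1 := hS.nc p c q e h hd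
  have N2 := hS.nc p e q c h (by rwa [Sym2.eq_swap])
  have i := fun u v => hk.eq_iff (a := u) (b := v)
  simp only [OnSide, Sym2.mem_iff, forall_eq_or_imp, forall_eq]
  simp only [Cyc4, L, Ne, ← i] at *
  grind

lemma side_both (hk : Function.Injective k) {p q v : P} (h1 : ¬ L k p q v) (h2 : ¬ L k q p v) : v = p ∨ v = q := by
  have i := fun u v => hk.eq_iff (a := u) (b := v)
  simp only [L, Ne, ← i] at *
  grind

/-- A neighbour of `{p,q}` on the side of the arc `p → q`. -/
lemma side_nbr (hk : Function.Injective k) (hS : NC k S) {p q : P} {d : Sym2 P}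
    (hd : OnSide k p q d) (h : FA k S d s(p, q)) : ∃ a, d = s(p, a) ∧ Consec k S p a q := by
  rw [FA_right] at h
  rcases h with h | ⟨c, rfl, h⟩
  · exact h
  · exfalso
    have h1 := h.2.2.1
    have h2 : ¬ L k p q c := hd c (by simp)
    refine h2 (L_rot' hk h1 ?_)
    rintro rfl; exact hS.nd _ h.1

lemma side_nbr' {p q : P} {d : Sym2 P}
    (hd : OnSide k p q d) (h : FA k S s(p, q) d) : ∃ a, d = s(q, a) ∧ Consec k S q p a := by
  rw [FA_left] at h
  rcases h with ⟨c, rfl, h⟩ | h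
  · exact absurd h.2.2.1 (hd c (by simp))
  · exact h

/-- Adjacent chords other than `{p,q}` lie on the same side of `{p,q}`. -/
lemma side_adj (hk : Function.Injective k) (hS : NC k S) {p q : P} (h : s(p, q) ∈ S)
    {d e : Sym2 P} (hde : FA k S d e) (hd : d ≠ s(p, q)) (he : e ≠ s(p, q)) :
    OnSide k p q d ↔ OnSide k p q e := by
  have hpq : p ≠ q := by rintro rfl; exact hS.nd _ h
  have key : ∀ p q : P, s(p, q) ∈ S → p ≠ q → d ≠ s(p, q) → e ≠ s(p, q) →
      OnSide k p q d → OnSide k q p e → False := by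
    clear h hpq hd he p q
    intro p q h hpq hd he h1 h2
    obtain ⟨x, a, b, rfl, rfl, hc⟩ := hde
    have xa : x ≠ a := by rintro rfl; exact hS.nd _ hc.1
    have xb : x ≠ b := by rintro rfl; exact hS.nd _ hc.2.1
    simp only [OnSide, Sym2.mem_iff, forall_eq_or_imp, forall_eq] at h1 h2
    have hx : x = p ∨ x = q := side_both hk h1.1 h2.1
    have i := fun u v => hk.eq_iff (a := u) (b := v)
    rcases hx with rfl | rfl
    · have ha : a ≠ q := by rintro rfl; exact hd rfl
      have hb : b ≠ q := by rintro rfl; exact he rfl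
      apply hc.2.2.2 q h
      simp only [L, Ne, ← i] at *
      grind
    · have ha : a ≠ p := by rintro rfl; exact hd Sym2.eq_swap
      have hb : b ≠ p := by rintro rfl; exact he Sym2.eq_swap
      have := hc.2.2.1
      simp only [L, Ne, ← i] at *
      grind
  have both : ∀ d : Sym2 P, d ∈ S → d ≠ s(p, q) → OnSide k p q d → OnSide k q p d → False := by
    intro d
    induction d with | _ a b =>
    intro hdS hd h1 h2
    simp only [OnSide, Sym2.mem_iff, forall_eq_or_imp, forall_eq] at h1 h2
    have hab : a ≠ b := by rintro rfl; exact hS.nd _ hdS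
    have h3 := side_both hk h1.1 h2.1
    have h4 := side_both hk h1.2 h2.2
    apply hd
    rw [Sym2.eq_iff]
    grind
  have hdS : d ∈ S := by obtain ⟨x, a, b, rfl, rfl, hc⟩ := hde; exact hc.1
  have heS : e ∈ S := by obtain ⟨x, a, b, rfl, rfl, hc⟩ := hde; exact hc.2.1
  constructor
  · intro h1
    by_contra h2
    exact key p q h hpq hd he h1 ((side_or hk hS h heS).resolve_left h2)
  · intro h1
    by_contra h2
    have h3 := (side_or hk hS h hdS).resolve_left h2
    rw [Sym2.eq_swap] at h hd he
    exact key q p h hpq.symm hd he h3 h1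

/-- Local structure: two distinct neighbours of a chord on the same side. -/
lemma side_local (hk : Function.Injective k) (hS : NC k S) {p q : P}
    {d e : Sym2 P} (hd : OnSide k p q d) (he : OnSide k p q e) (hne : d ≠ e)
    (h1 : FA k S d s(p, q) ∨ FA k S s(p, q) d) (h2 : FA k S e s(p, q) ∨ FA k S s(p, q) e) :
    FR k S d s(p, q) e ∨ FR k S e s(p, q) d := by
  rcases h1 with h1 | h1 <;> rcases h2 with h2 | h2
  · obtain ⟨a, rfl, g1⟩ := side_nbr hk hS hd h1
    obtain ⟨b, rfl, g2⟩ := side_nbr hk hS he h2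
    exact absurd (by rw [g1.uniq_left hk g2]) hne
  · obtain ⟨a, rfl, g1⟩ := side_nbr hk hS hd h1
    obtain ⟨b, rfl, g2⟩ := side_nbr' he h2
    exact Or.inl ⟨_, _, _, _, rfl, rfl, rfl, g1, g2⟩
  · obtain ⟨a, rfl, g1⟩ := side_nbr' hd h1
    obtain ⟨b, rfl, g2⟩ := side_nbr hk hS he h2
    exact Or.inr ⟨_, _, _, _, rfl, rfl, rfl, g2, g1⟩
  · obtain ⟨a, rfl, g1⟩ := side_nbr' hd h1
    obtain ⟨b, rfl, g2⟩ := side_nbr' he h2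
    exact absurd (by rw [g1.uniq_right hk g2]) hne

end FanPair

section Cycles
variable {P K : Type} [LinearOrder K] {k : P → K} {S : Set (Sym2 P)}

lemma FA_mem {α β : Sym2 P} (h : FA k S α β) : α ∈ S ∧ β ∈ S := by
  obtain ⟨x, a, b, rfl, rfl, hc⟩ := h
  exact ⟨hc.1, hc.2.1⟩

lemma natCast_ne_zero_of_lt {r n : ℕ} (h0 : 0 < n) (h : n < r) : (n : ZMod r) ≠ 0 := by
  rw [Ne, ZMod.natCast_eq_zero_iff]
  exact fun hd => absurd (Nat.le_of_dvd h0 hd) (by omega)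

lemma cycle_local (hk : Function.Injective k) (hS : NC k S) {r : ℕ} {v : ZMod r → Sym2 P}
    (hv : (fanPair k S).UndirCycle r v) (i : ZMod r) :
    FR k S (v (i - 1)) (v i) (v (i + 1)) ∨ FR k S (v (i + 1)) (v i) (v (i - 1)) := by
  obtain ⟨hr, hinj, hadj⟩ := hv
  simp only [fanPair] at hadj
  have hiS : v i ∈ S := by
    rcases hadj i with h | h
    · exact (FA_mem h).1
    · exact (FA_mem h).2
  have hi1S : v (i + 1) ∈ S := by
    rcases hadj i with h | h
    · exact (FA_mem h).2
    · exact (FA_mem h).1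
  have hne : ∀ n : ℕ, n + 2 ≤ r → v (i + 1 + n) ≠ v i := by
    intro n hn h
    have h1 : i + 1 + n = i := hinj h
    have h2 : ((n + 1 : ℕ) : ZMod r) = 0 := by
      push_cast
      linear_combination h1
    exact natCast_ne_zero_of_lt (by omega) (by omega) h2
  have hlast : i + 1 + ((r - 2 : ℕ) : ZMod r) = i - 1 := by
    have : ((r - 2 : ℕ) : ZMod r) = -2 := by
      rw [Nat.cast_sub (by omega)]; simp
    rw [this]; ring
  have main : ∀ p q : P, v i = s(p, q) → OnSide k p q (v (i + 1)) →
      FR k S (v (i - 1)) (v i) (v (i + 1)) ∨ FR k S (v (i + 1)) (v i) (v (i - 1)) := by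
    intro p q hpq hside
    have hpqS : s(p, q) ∈ S := hpq ▸ hiS
    have hall : ∀ n : ℕ, n + 2 ≤ r → OnSide k p q (v (i + 1 + n)) := by
      intro n
      induction n with
      | zero => intro _; simpa using hside
      | succ n ih =>
        intro hn
        have e1 := hne n (by omega)
        have e2 := hne (n + 1) hn
        rw [hpq] at e1 e2
        have ih := ih (by omega)
        have e3 : i + 1 + ((n + 1 : ℕ) : ZMod r) = i + 1 + n + 1 := by push_cast; ring
        rw [e3] at e2 ⊢
        rcases hadj (i + 1 + n) with h | h
        · exact (side_adj hk hS hpqS h e1 e2).1 ih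
        · exact (side_adj hk hS hpqS h e2 e1).2 ih
    have hl := hall (r - 2) (by omega)
    rw [hlast] at hl
    have hne2 : v (i - 1) ≠ v (i + 1) := by
      intro h
      have h1 : i - 1 = i + 1 := hinj h
      have h2 : ((2 : ℕ) : ZMod r) = 0 := by
        push_cast
        linear_combination -h1
      exact natCast_ne_zero_of_lt (by omega) (by omega) h2
    have a1 := hadj (i - 1)
    rw [sub_add_cancel] at a1
    have a2 := hadj i
    rw [hpq] at a1 a2 ⊢
    exact side_local hk hS hl hside hne2 a1 a2.symm
  obtain ⟨p, q, hpq⟩ : ∃ p q, v i = s(p, q) := by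
    induction h : v i with | _ p q => exact ⟨p, q, rfl⟩
  rcases side_or hk hS (hpq ▸ hiS) hi1S with h | h
  · exact main p q hpq h
  · exact main q p (by rw [hpq, Sym2.eq_swap]) h

lemma zmod_ind {r : ℕ} (hr : 3 ≤ r) (p : ZMod r → Prop) (h0 : p 0) (hs : ∀ i, p i → p (i + 1)) :
    ∀ i, p i := by
  haveI : NeZero r := ⟨by omega⟩
  have : ∀ n : ℕ, p n := by
    intro n
    induction n with
    | zero => simpa using h0
    | succ n ih => push_cast; exact hs _ ih
  intro i
  rw [← ZMod.natCast_zmod_val i]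
  exact this _

lemma fan_cycles (hk : Function.Injective k) (hS : NC k S) : (fanPair k S).CyclesOrientedFull := by
  constructor
  · intro r v hv
    have hl := fun i => cycle_local hk hS hv (i + 1)
    simp only [add_sub_cancel_right] at hl
    rcases hv.2.2 0 with h | h
    · left
      refine zmod_ind hv.1 _ h fun i hi => ?_
      rcases hl i with h1 | h1
      · exact (FR_FA h1).2
      · exact absurd (FR_FA h1).2 (FA_asymm hi)
    · right
      refine zmod_ind hv.1 _ h fun i hi => ?_
      rcases hl i with h1 | h1
      · exact absurd (FR_FA h1).1 (FA_asymm hi)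
      · exact (FR_FA h1).1
  · intro r v hv i
    have := cycle_local hk hS (v := v) ⟨hv.1, hv.2.1, fun i => Or.inl (hv.2.2 i)⟩ (i + 1)
    rw [add_sub_cancel_right, show i + 1 + 1 = i + 2 by ring] at this
    rcases this with h1 | h1
    · exact h1
    · exact absurd (FR_FA h1).2 (FA_asymm (hv.2.2 i))

end Cycles

section Pull
variable {V W : Type} {G : GPair V} {H : GPair W}

lemma EG.pull (h : EG H) (e : V → W) (he : Function.Injective e)
    (hA : ∀ x y, G.Arr x y ↔ H.Arr (e x) (e y))
    (hR : ∀ x y z, G.Rel x y z ↔ H.Rel (e x) (e y) (e z)) : EG G where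
  rel h1 := by rw [hR] at h1; rw [hA, hA]; exact h.rel h1
  irr x h1 := by rw [hA] at h1; exact h.irr _ h1
  asym h1 h2 := by rw [hA] at h1 h2; exact h.asym h1 h2
  out2 h1 h2 h3 := by
    rw [hA] at h1 h2 h3
    simpa only [he.eq_iff] using h.out2 h1 h2 h3
  in2 h1 h2 h3 := by
    rw [hA] at h1 h2 h3
    simpa only [he.eq_iff] using h.in2 h1 h2 h3
  nro h1 h2 h3 h4 h5 := by
    rw [hA] at h1 h2 h4; rw [hR] at h3 h5
    exact he (h.nro h1 h2 h3 h4 h5)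
  nri h1 h2 h3 h4 h5 := by
    rw [hA] at h1 h2 h4; rw [hR] at h3 h5
    exact he (h.nri h1 h2 h3 h4 h5)
  ro h1 h2 := by rw [hR] at h1 h2; exact he (h.ro h1 h2)
  ri h1 h2 := by rw [hR] at h1 h2; exact he (h.ri h1 h2)

lemma Cyc.pull (h : H.CyclesOrientedFull) (e : V → W) (he : Function.Injective e)
    (hA : ∀ x y, G.Arr x y ↔ H.Arr (e x) (e y))
    (hR : ∀ x y z, G.Rel x y z ↔ H.Rel (e x) (e y) (e z)) : G.CyclesOrientedFull := by
  constructor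
  · intro r v hv
    have := h.1 r (e ∘ v) ⟨hv.1, he.comp hv.2.1, fun i => by simpa [hA] using hv.2.2 i⟩
    simpa [hA] using this
  · intro r v hv
    have := h.2 r (e ∘ v) ⟨hv.1, he.comp hv.2.1, fun i => by simpa [hA] using hv.2.2 i⟩
    simpa [hR] using this

end Pull

lemma part_a (M : ℕ) (hM : 2 ≤ M) (S : Set (Sym2 (ZMod M))) (hS : IsTiling S) :
    (tilingPair S).IsGentle ∧ (tilingPair S).CyclesOrientedFull := by
  haveI : NeZero M := ⟨by omega⟩
  have hN := (tiling_NC 0 S).1 hS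
  have hk := kp_inj (0 : ZMod M)
  have hA : ∀ x y : {d // d ∈ S}, (tilingPair S).Arr x y ↔ (fanPair (kp 0) S).Arr x.1 y.1 :=
    fun x y => QArr_iff 0 hN _ _
  have hR : ∀ x y z : {d // d ∈ S}, (tilingPair S).Rel x y z ↔
    (fanPair (kp 0) S).Rel x.1 y.1 z.1 := fun x y z => QRel_iff 0 hN _ _ _
  rw [gentle_iff]
  exact ⟨(fan_EG hk hN.nd).pull _ Subtype.val_injective hA hR,
    Cyc.pull (fan_cycles hk hN) _ Subtype.val_injective hA hR⟩

lemma part_b_rev {V : Type} {G : GPair V} (h : ∃ (M : ℕ), 2 ≤ M ∧ ∃ S : Set (Sym2 (ZMod M)),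
    IsTiling S ∧ G.Iso (tilingPair S)) : G.IsGentle ∧ G.CyclesOrientedFull := by
  obtain ⟨M, hM, S, hS, e, hA, hR⟩ := h
  obtain ⟨h1, h2⟩ := part_a M hM S hS
  rw [gentle_iff] at h1 ⊢
  exact ⟨h1.pull e e.injective hA hR, Cyc.pull h2 e e.injective hA hR⟩

section Ins
variable {P K : Type*} [LinearOrder K] {k : P → K} {S : Set (Sym2 P)}

def Last (k : P → K) (S : Set (Sym2 P)) (p a : P) : Prop :=
  s(p, a) ∈ S ∧ ∀ c, s(p, c) ∈ S → ¬ L k p a c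
def First (k : P → K) (S : Set (Sym2 P)) (q b : P) : Prop :=
  s(q, b) ∈ S ∧ ∀ c, s(q, c) ∈ S → ¬ L k q c b

/-- Insertion data for a new chord `{p,q}`. -/
structure Ins (k : P → K) (S : Set (Sym2 P)) (p q : P) : Prop where
  ne : p ≠ q
  hp : ∀ c, s(p, c) ∈ S → L k p c q
  hq : ∀ c, s(q, c) ∈ S → L k q p c

lemma Ins.notMem {p q : P} (h : Ins k S p q) : s(p, q) ∉ S := fun h1 => L_irr (h.hp q h1)

lemma Ins.consec {p q : P} (h : Ins k S p q) {x a b : P} :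
    Consec k (insert s(p, q) S) x a b ↔
      Consec k S x a b ∨ (x = p ∧ b = q ∧ Last k S p a) ∨ (x = q ∧ a = p ∧ First k S q b) := by
  have hne := h.ne
  have hp := h.hp
  have hq := h.hq
  unfold Consec Last First
  simp only [Set.mem_insert_iff]
  constructor
  · rintro ⟨h1, h2, h3, h4⟩
    rcases h1 with h1 | h1 <;> rcases h2 with h2 | h2
    · rw [← h2] at h1
      have := Sym2.congr_right.1 h1
      subst this
      exact absurd h3 L_irr
    · rcases Sym2.eq_iff.1 h1 with ⟨rfl, rfl⟩ | ⟨rfl, rfl⟩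
      · exact absurd h3 fun h3 => L_asymm h3 (hp _ h2)
      · exact Or.inr (Or.inr ⟨rfl, rfl, h2, fun c hc hc' => h4 c (Or.inr hc) ⟨hq _ hc, hc'⟩⟩)
    · rcases Sym2.eq_iff.1 h2 with ⟨rfl, rfl⟩ | ⟨rfl, rfl⟩
      · exact Or.inr (Or.inl ⟨rfl, rfl, h1, fun c hc hc' => h4 c (Or.inr hc) ⟨hc', hp _ hc⟩⟩)
      · exact absurd h3 fun h3 => L_asymm h3 (hq _ h1)
    · exact Or.inl ⟨h1, h2, h3, fun c hc => h4 c (Or.inr hc)⟩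
  · rintro (⟨h1, h2, h3, h4⟩ | ⟨rfl, rfl, h1, h2⟩ | ⟨rfl, rfl, h1, h2⟩)
    · refine ⟨Or.inr h1, Or.inr h2, h3, ?_⟩
      rintro c (hc | hc) ⟨h5, h6⟩
      · rcases Sym2.eq_iff.1 hc with ⟨rfl, rfl⟩ | ⟨rfl, rfl⟩
        · exact L_asymm h6 (hp _ h2)
        · exact L_asymm h5 (hq _ h1)
      · exact h4 c hc ⟨h5, h6⟩
    · refine ⟨Or.inr h1, Or.inl rfl, hp _ h1, ?_⟩
      rintro c (hc | hc) ⟨h5, h6⟩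
      · rw [Sym2.congr_right.1 hc] at h6
        exact L_irr h6
      · exact h2 c hc h5
    · refine ⟨Or.inl Sym2.eq_swap, Or.inr h1, hq _ h1, ?_⟩
      rintro c (hc | hc) ⟨h5, h6⟩
      · rw [Sym2.eq_swap] at hc
        rw [Sym2.congr_left.1 hc] at h5
        exact L_irr h5
      · exact h2 c hc h6

lemma Ins.FA_old {p q : P} (h : Ins k S p q) {α β : Sym2 P} (hα : α ∈ S) (hβ : β ∈ S) :
    FA k (insert s(p, q) S) α β ↔ FA k S α β := by
  have hn := h.notMem
  unfold FA
  simp only [h.consec]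
  constructor
  · rintro ⟨x, a, b, rfl, rfl, h1 | ⟨rfl, rfl, -⟩ | ⟨rfl, rfl, -⟩⟩
    · exact ⟨_, _, _, rfl, rfl, h1⟩
    · exact absurd hβ hn
    · exact absurd (Sym2.eq_swap ▸ hα) hn
  · rintro ⟨x, a, b, rfl, rfl, h1⟩
    exact ⟨_, _, _, rfl, rfl, Or.inl h1⟩

lemma Ins.FA_in {p q : P} (h : Ins k S p q) {α : Sym2 P} (hα : α ∈ S) :
    FA k (insert s(p, q) S) α s(p, q) ↔ ∃ a, α = s(p, a) ∧ Last k S p a := by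
  have hn := h.notMem
  unfold FA
  simp only [h.consec]
  constructor
  · rintro ⟨x, a, b, rfl, e, h1 | ⟨rfl, rfl, h1⟩ | ⟨rfl, rfl, -⟩⟩
    · exact absurd (e ▸ h1.2.1) hn
    · exact ⟨_, rfl, h1⟩
    · exact absurd (Sym2.eq_swap ▸ hα) hn
  · rintro ⟨a, rfl, h1⟩
    exact ⟨_, _, _, rfl, rfl, Or.inr (Or.inl ⟨rfl, rfl, h1⟩)⟩

lemma Ins.FA_out {p q : P} (h : Ins k S p q) {β : Sym2 P} (hβ : β ∈ S) :
    FA k (insert s(p, q) S) s(p, q) β ↔ ∃ b, β = s(q, b) ∧ First k S q b := by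
  have hn := h.notMem
  unfold FA
  simp only [h.consec]
  constructor
  · rintro ⟨x, a, b, e, rfl, h1 | ⟨rfl, rfl, h1⟩ | ⟨rfl, rfl, h1⟩⟩
    · exact absurd (e ▸ h1.1) hn
    · exact absurd hβ hn
    · exact ⟨_, rfl, h1⟩
  · rintro ⟨a, rfl, h1⟩
    exact ⟨_, _, _, Sym2.eq_swap, rfl, Or.inr (Or.inr ⟨rfl, rfl, h1⟩)⟩

lemma Ins.FR_old {p q : P} (h : Ins k S p q) {α β γ : Sym2 P} (hα : α ∈ S) (hβ : β ∈ S)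
    (hγ : γ ∈ S) : FR k (insert s(p, q) S) α β γ ↔ FR k S α β γ := by
  have hn := h.notMem
  have hn' : s(q, p) ∉ S := by rwa [Sym2.eq_swap]
  unfold FR
  simp only [h.consec]
  constructor
  · rintro ⟨x, y, a, c, rfl, rfl, rfl, h1 | ⟨rfl, rfl, -⟩ | ⟨rfl, rfl, -⟩, h2⟩
    · rcases h2 with h2 | ⟨rfl, rfl, -⟩ | ⟨rfl, rfl, -⟩
      · exact ⟨_, _, _, _, rfl, rfl, rfl, h1, h2⟩
      · exact absurd hγ hn
      · exact absurd hβ hn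
    · exact absurd hβ hn
    · exact absurd hα hn'
  · rintro ⟨x, y, a, c, rfl, rfl, rfl, h1, h2⟩
    exact ⟨_, _, _, _, rfl, rfl, rfl, Or.inl h1, Or.inl h2⟩

lemma Ins.FR_in {p q : P} (h : Ins k S p q) {α β : Sym2 P} (hα : α ∈ S) (hβ : β ∈ S) :
    FR k (insert s(p, q) S) α β s(p, q) ↔
      ∃ x a, α = s(x, a) ∧ β = s(x, p) ∧ Consec k S x a p ∧ Last k S p x := by
  have hn := h.notMem
  have hn' : s(q, p) ∉ S := by rwa [Sym2.eq_swap]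
  unfold FR
  simp only [h.consec]
  constructor
  · rintro ⟨x, y, a, c, rfl, rfl, e, h1 | ⟨rfl, rfl, -⟩ | ⟨rfl, rfl, -⟩, h2⟩
    · rcases h2 with h2 | ⟨rfl, rfl, h2⟩ | ⟨rfl, rfl, h2⟩
      · exact absurd (e ▸ h2.2.1) hn
      · exact ⟨_, _, rfl, rfl, h1, h2⟩
      · exact absurd hβ hn
    · exact absurd hβ hn
    · exact absurd hα hn'
  · rintro ⟨x, a, rfl, rfl, h1, h2⟩
    exact ⟨_, _, _, _, rfl, rfl, rfl, Or.inl h1, Or.inr (Or.inl ⟨rfl, rfl, h2⟩)⟩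

lemma Ins.FR_out {p q : P} (h : Ins k S p q) {β γ : Sym2 P} (hβ : β ∈ S) (hγ : γ ∈ S) :
    FR k (insert s(p, q) S) s(p, q) β γ ↔
      ∃ y c, β = s(q, y) ∧ γ = s(y, c) ∧ First k S q y ∧ Consec k S y q c := by
  have hn := h.notMem
  have hn' : s(q, p) ∉ S := by rwa [Sym2.eq_swap]
  unfold FR
  simp only [h.consec]
  constructor
  · rintro ⟨x, y, a, c, e, rfl, rfl, h1 | ⟨rfl, rfl, -⟩ | ⟨rfl, rfl, h1⟩, h2⟩
    · exact absurd (e ▸ h1.1) hn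
    · exact absurd hβ hn
    · rcases h2 with h2 | ⟨rfl, rfl, h2⟩ | ⟨rfl, rfl, h2⟩
      · exact ⟨_, _, rfl, rfl, h1, h2⟩
      · exact absurd hβ hn'
      · exact absurd rfl h.ne
  · rintro ⟨y, c, rfl, rfl, h1, h2⟩
    exact ⟨_, _, _, _, Sym2.eq_swap, rfl, rfl, Or.inr (Or.inr ⟨rfl, rfl, h1⟩), Or.inl h2⟩

lemma Ins.FR_mid {p q : P} (h : Ins k S p q) {α γ : Sym2 P} (hα : α ∈ S) (hγ : γ ∈ S) :
    FR k (insert s(p, q) S) α s(p, q) γ ↔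
      (∃ a, α = s(p, a) ∧ Last k S p a) ∧ (∃ b, γ = s(q, b) ∧ First k S q b) := by
  constructor
  · intro h1
    have := FR_FA h1
    rwa [h.FA_in hα, h.FA_out hγ] at this
  · rintro ⟨⟨a, rfl, h1⟩, ⟨b, rfl, h2⟩⟩
    refine ⟨p, q, a, b, rfl, rfl, rfl, ?_, ?_⟩
    · rw [h.consec]; exact Or.inr (Or.inl ⟨rfl, rfl, h1⟩)
    · rw [h.consec]; exact Or.inr (Or.inr ⟨rfl, rfl, h2⟩)

end Ins

section Ext
variable {P K : Type*} [LinearOrder K] {k : P → K} {V : Type} {G : GPair V}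

structure Realize (k : P → K) (G : GPair V) (U : Set V) (f : V → Sym2 P) : Prop where
  nc : NC k (f '' U)
  inj : Set.InjOn f U
  arr : ∀ x ∈ U, ∀ y ∈ U, (G.Arr x y ↔ FA k (f '' U) (f x) (f y))
  rel : ∀ x ∈ U, ∀ y ∈ U, ∀ z ∈ U, (G.Rel x y z ↔ FR k (f '' U) (f x) (f y) (f z))

lemma NC_insert (hk : Function.Injective k) {S : Set (Sym2 P)} (hS : NC k S) {p q : P} (h : p ≠ q)
    (hc : ∀ c d, s(c, d) ∈ S → ¬ Cyc4 k p c q d) : NC k (insert s(p, q) S) := by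
  constructor
  · intro a ha
    rcases Set.mem_insert_iff.1 ha with ha | ha
    · rcases Sym2.eq_iff.1 ha with ⟨rfl, rfl⟩ | ⟨rfl, rfl⟩ <;> exact h rfl
    · exact hS.nd a ha
  · have i := fun u v => hk.eq_iff (a := u) (b := v)
    intro a b c d h1 h2 h3
    rcases Set.mem_insert_iff.1 h1 with h1 | h1 <;> rcases Set.mem_insert_iff.1 h2 with h2 | h2
    · rw [Sym2.eq_iff] at h1 h2
      simp only [Cyc4, L, Ne, ← i] at *; grind
    · have h5 := hc _ _ h2
      have h6 := hc _ _ (Sym2.eq_swap ▸ h2)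
      rw [Sym2.eq_iff] at h1
      simp only [Cyc4, L, Ne, ← i] at *; grind
    · have h5 := hc _ _ h1
      have h6 := hc _ _ (Sym2.eq_swap ▸ h1)
      rw [Sym2.eq_iff] at h2
      simp only [Cyc4, L, Ne, ← i] at *; grind
    · exact hS.nc _ _ _ _ h1 h2 h3

lemma Realize.extend [DecidableEq V] (hk : Function.Injective k) (hG : EG G) {U : Set V} {f : V → Sym2 P}
    (h : Realize k G U f) {z : V} (hz : z ∉ U) {p q : P} (hi : Ins k (f '' U) p q)
    (hc : ∀ c d, s(c, d) ∈ f '' U → ¬ Cyc4 k p c q d)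
    (h1 : ∀ y ∈ U, (G.Arr y z ↔ ∃ a, f y = s(p, a) ∧ Last k (f '' U) p a))
    (h2 : ∀ w ∈ U, (G.Arr z w ↔ ∃ a, f w = s(q, a) ∧ First k (f '' U) q a))
    (h3 : ∀ x ∈ U, ∀ y ∈ U, (G.Rel x y z ↔ ∃ x' a, f x = s(x', a) ∧ f y = s(x', p) ∧
      Consec k (f '' U) x' a p ∧ Last k (f '' U) p x'))
    (h4 : ∀ w ∈ U, ∀ v ∈ U, (G.Rel z w v ↔ ∃ y c, f w = s(q, y) ∧ f v = s(y, c) ∧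
      First k (f '' U) q y ∧ Consec k (f '' U) y q c))
    (h5 : ∀ y ∈ U, ∀ w ∈ U, G.Arr y z → G.Arr z w → G.Rel y z w) :
    Realize k G (insert z U) (Function.update f z s(p, q)) := by
  have e1 : ∀ x ∈ U, Function.update f z s(p, q) x = f x := by
    intro x hx
    rw [Function.update_of_ne]
    rintro rfl; exact hz hx
  have e2 : Function.update f z s(p, q) z = s(p, q) := by simp
  have e3 : Function.update f z s(p, q) '' (insert z U) = insert s(p, q) (f '' U) := by
    rw [Set.image_insert_eq, e2]
    congr 1
    exact Set.image_congr e1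
  have m : ∀ x ∈ U, f x ∈ f '' U := fun x hx => ⟨x, hx, rfl⟩
  have hn := hi.notMem
  refine ⟨?_, ?_, ?_, ?_⟩
  · rw [e3]; exact NC_insert hk h.nc hi.ne hc
  · rintro x (rfl | hx) y (rfl | hy) e
    · rfl
    · rw [e2, e1 y hy] at e; exact absurd (e ▸ m y hy) hn
    · rw [e2, e1 x hx] at e; exact absurd (e ▸ m x hx) hn
    · rw [e1 x hx, e1 y hy] at e; exact h.inj hx hy e
  · rw [e3]
    rintro x (rfl | hx) y (rfl | hy)
    · exact iff_of_false (hG.irr _) (FA_irr _)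
    · rw [e2, e1 y hy, hi.FA_out (m y hy)]; exact h2 y hy
    · rw [e2, e1 x hx, hi.FA_in (m x hx)]; exact h1 x hx
    · rw [e1 x hx, e1 y hy, hi.FA_old (m x hx) (m y hy)]; exact h.arr x hx y hy
  · rw [e3]
    rintro x (rfl | hx) y (rfl | hy) w (rfl | hw)
    · exact iff_of_false (fun h => hG.irr _ (hG.rel h).1) (fun h => FA_irr _ (FR_FA h).1)
    · exact iff_of_false (fun h => hG.irr _ (hG.rel h).1) (fun h => FA_irr _ (FR_FA h).1)
    · exact iff_of_false (fun h => hG.asym (hG.rel h).1 (hG.rel h).2)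
        (fun h => FA_asymm (FR_FA h).1 (FR_FA h).2)
    · rw [e2, e1 y hy, e1 w hw, hi.FR_out (m y hy) (m w hw)]; exact h4 y hy w hw
    · exact iff_of_false (fun h => hG.irr _ (hG.rel h).2) (fun h => FA_irr _ (FR_FA h).2)
    · rw [e2, e1 x hx, e1 w hw, hi.FR_mid (m x hx) (m w hw), ← h1 x hx, ← h2 w hw]
      exact ⟨hG.rel, fun hh => h5 x hx w hw hh.1 hh.2⟩
    · rw [e2, e1 x hx, e1 y hy, hi.FR_in (m x hx) (m y hy)]; exact h3 x hx y hy
    · rw [e1 x hx, e1 y hy, e1 w hw, hi.FR_old (m x hx) (m y hy) (m w hw)]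
      exact h.rel x hx y hy w hw

end Ext

section Slot
variable {P K : Type*} [LinearOrder K] {k : P → K} {S : Set (Sym2 P)} {V : Type} {G : GPair V}

lemma fan_finite (hf : S.Finite) (p : P) : {c | s(p, c) ∈ S}.Finite :=
  hf.preimage (f := fun c => s(p, c)) (fun _ _ _ _ h => Sym2.congr_right.1 h)

lemma succ_exists (hf : S.Finite) {p a : P} (h : s(p, a) ∈ S) (hl : ¬ Last k S p a) :
    ∃ c, Consec k S p a c := by
  unfold Last at hl
  push Not at hl
  obtain ⟨c, hc, hl⟩ := hl h
  have hT : {c | s(p, c) ∈ S ∧ L k p a c}.Finite := (fan_finite hf p).subset fun c hc => hc.1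
  have := hT.to_subtype
  let r : {c | s(p, c) ∈ S ∧ L k p a c} → {c | s(p, c) ∈ S ∧ L k p a c} → Prop :=
    fun c d => L k p c.1 d.1
  have : IsTrans _ r := ⟨fun _ _ _ => L_trans⟩
  have : Std.Irrefl r := ⟨fun _ => L_irr⟩
  have wf : WellFounded r := Finite.wellFounded_of_trans_of_irrefl r
  obtain ⟨⟨m, hm1, hm2⟩, -, hm⟩ := wf.has_min Set.univ ⟨⟨c, hc, hl⟩, trivial⟩
  exact ⟨m, h, hm1, hm2, fun d hd h' => hm ⟨d, hd, h'.1⟩ trivial h'.2⟩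

lemma Realize.out_slot (hG : EG G) (hk : Function.Injective k) {U : Set V} {f : V → Sym2 P}
    (h : Realize k G U f) (hf : (f '' U).Finite) {y z : V} (hy : y ∈ U) (hz : z ∉ U) (hyz : G.Arr y z) :
    ∃ p a, f y = s(p, a) ∧ Last k (f '' U) p a ∧
      ∀ x ∈ U, (G.Rel x y z ↔ ∃ a', f x = s(a, a') ∧ Consec k (f '' U) a a' p) := by
  have nd := h.nc.nd
  have my : f y ∈ f '' U := ⟨y, hy, rfl⟩
  have key : ∀ p a, f y = s(p, a) → ¬ Last k (f '' U) p a →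
      ∃ u ∈ U, ∃ c, Consec k (f '' U) p a c ∧ f u = s(p, c) ∧ G.Arr y u := by
    intro p a e hl
    obtain ⟨c, hc⟩ := succ_exists hf (e ▸ my) hl
    obtain ⟨u, hu, hu'⟩ := hc.2.1
    refine ⟨u, hu, c, hc, hu', ?_⟩
    rw [h.arr y hy u hu]
    exact ⟨_, _, _, e, hu', hc⟩
  by_cases hA : ∃ u ∈ U, G.Arr y u
  · obtain ⟨u, hu, hyu⟩ := hA
    obtain ⟨b', p, c, e1, e2, hc⟩ := (h.arr y hy u hu).1 hyu
    have hzu : z ≠ u := by rintro rfl; exact hz hu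
    have hl : Last k (f '' U) p b' := by
      by_contra hl
      obtain ⟨u', hu', c', hc', e3, hyu'⟩ := key p b' (by rw [e1, Sym2.eq_swap]) hl
      have hzu' : z ≠ u' := by rintro rfl; exact hz hu'
      rcases hG.out2 hyz hyu hyu' with h1 | h1 | h1
      · exact hzu h1
      · exact hzu' h1
      · subst h1
        rw [e2] at e3
        rcases Sym2.eq_iff.1 e3 with ⟨h1, -⟩ | ⟨-, h1⟩
        · subst h1; exact nd _ (e1 ▸ my)
        · exact hc.ne h1.symm
    refine ⟨p, b', by rw [e1, Sym2.eq_swap], hl, ?_⟩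
    intro x hx
    constructor
    · intro hr
      have hxy := (h.arr x hx y hy).1 (hG.rel hr).1
      rw [e1, FA_right] at hxy
      rcases hxy with hxy | ⟨a', e3, h3⟩
      · exact hxy
      · exfalso
        refine hzu (hG.ro hr ?_)
        rw [h.rel x hx y hy u hu]
        exact ⟨p, b', a', c, e3, by rw [e1, Sym2.eq_swap], e2, h3, hc⟩
    · rintro ⟨a', e3, h3⟩
      have hxy : G.Arr x y := (h.arr x hx y hy).2 ⟨_, _, _, e3, e1, h3⟩
      by_contra hr
      by_cases hr' : G.Rel x y u
      · rw [h.rel x hx y hy u hu, e3, e1, FR_iff h3] at hr'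
        obtain ⟨c', e4, h4⟩ := hr'
        exact hl.2 _ h4.2.1 h4.2.2.1
      · exact hzu (hG.nro hxy hyz hr hyu hr')
  · push Not at hA
    have hl : ∀ p a, f y = s(p, a) → Last k (f '' U) p a := by
      intro p a e
      by_contra hl
      obtain ⟨u, hu, -, -, -, h1⟩ := key p a e hl
      exact hA u hu h1
    by_cases hB1 : ∃ x ∈ U, G.Rel x y z
    · obtain ⟨x, hx, hr⟩ := hB1
      obtain ⟨x0, a', p, e1, e2, hc⟩ := (h.arr x hx y hy).1 (hG.rel hr).1
      have e2' : f y = s(p, x0) := by rw [e2, Sym2.eq_swap]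
      refine ⟨p, x0, e2', hl _ _ e2', ?_⟩
      intro x' hx'
      constructor
      · intro hr'
        obtain rfl := hG.ri hr hr'
        exact ⟨a', e1, hc⟩
      · rintro ⟨a'', e3, hc'⟩
        obtain rfl := hc.uniq_left hk hc'
        rwa [h.inj hx' hx (e3.trans e1.symm)]
    · push Not at hB1
      by_cases hB2 : ∃ x ∈ U, G.Arr x y
      · obtain ⟨x, hx, hxy⟩ := hB2
        obtain ⟨x0, a', b, e1, e2, hc⟩ := (h.arr x hx y hy).1 hxy
        refine ⟨x0, b, e2, hl _ _ e2, ?_⟩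
        intro x' hx'
        refine iff_of_false (hB1 x' hx') ?_
        rintro ⟨a'', e3, hc'⟩
        have hxy' : G.Arr x' y := (h.arr x' hx' y hy).2 ⟨_, _, _, e3, by rw [e2, Sym2.eq_swap], hc'⟩
        obtain rfl := hG.nri hyz hxy (hB1 _ hx) hxy' (hB1 _ hx')
        rw [e1] at e3
        rcases Sym2.eq_iff.1 e3 with ⟨h1, -⟩ | ⟨-, h1⟩
        · subst h1; exact nd _ (e2 ▸ my)
        · exact hc.ne h1
      · push Not at hB2
        obtain ⟨p, a, e⟩ : ∃ p a, f y = s(p, a) := by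
          induction h : f y with | _ p q => exact ⟨p, q, rfl⟩
        refine ⟨p, a, e, hl _ _ e, fun x hx => iff_of_false (hB1 x hx) ?_⟩
        rintro ⟨a', e3, h3⟩
        exact hB2 x hx ((h.arr x hx y hy).2 ⟨_, _, _, e3, by rw [e, Sym2.eq_swap], h3⟩)

end Slot

section Dual
variable {P K : Type*} [LinearOrder K] {k : P → K} {S : Set (Sym2 P)} {V : Type} {G : GPair V}

abbrev kd (k : P → K) : P → Kᵒᵈ := fun x => OrderDual.toDual (k x)

lemma kd_inj (hk : Function.Injective k) : Function.Injective (kd k) := fun _ _ h => hk (OrderDual.toDual.injective h)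

lemma L_kd (hk : Function.Injective k) {x a b : P} (ha : a ≠ x) (hb : b ≠ x) : L (kd k) x a b ↔ L k x b a := by
  have i := fun u v => hk.eq_iff (a := u) (b := v)
  simp only [L, Ne, ← i, kd, OrderDual.toDual_le_toDual, OrderDual.toDual_lt_toDual] at *
  grind

lemma Cyc4_kd (hk : Function.Injective k) {a b c d : P} : Cyc4 (kd k) a b c d ↔ Cyc4 k a d c b := by
  have i := fun u v => hk.eq_iff (a := u) (b := v)
  simp only [L, Cyc4, Ne, ← i, kd, OrderDual.toDual_le_toDual, OrderDual.toDual_lt_toDual] at *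
  grind

lemma ne_of_nd (nd : ∀ a, s(a, a) ∉ S) {x a : P} (h : s(x, a) ∈ S) : a ≠ x := by
  rintro rfl; exact nd _ h

lemma Consec_kd (hk : Function.Injective k) (nd : ∀ a, s(a, a) ∉ S) {x a b : P} :
    Consec (kd k) S x a b ↔ Consec k S x b a := by
  have n := fun a (h : s(x, a) ∈ S) => ne_of_nd nd h
  unfold Consec
  constructor
  · rintro ⟨h1, h2, h3, h4⟩
    refine ⟨h2, h1, (L_kd hk (n _ h1) (n _ h2)).1 h3, fun c hc h => h4 c hc ?_⟩
    rw [L_kd hk (n _ h1) (n _ hc), L_kd hk (n _ hc) (n _ h2)]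
    exact h.symm
  · rintro ⟨h2, h1, h3, h4⟩
    refine ⟨h1, h2, (L_kd hk (n _ h1) (n _ h2)).2 h3, fun c hc h => h4 c hc ?_⟩
    rw [L_kd hk (n _ h1) (n _ hc), L_kd hk (n _ hc) (n _ h2)] at h
    exact h.symm

lemma Last_kd (hk : Function.Injective k) (nd : ∀ a, s(a, a) ∉ S) {x a : P} :
    Last (kd k) S x a ↔ First k S x a := by
  have n := fun a (h : s(x, a) ∈ S) => ne_of_nd nd h
  unfold Last First
  refine and_congr_right fun h => forall_congr' fun c => imp_congr_right fun hc => ?_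
  rw [L_kd hk (n _ h) (n _ hc)]

lemma FA_kd (hk : Function.Injective k) (nd : ∀ a, s(a, a) ∉ S) {α β : Sym2 P} :
    FA (kd k) S α β ↔ FA k S β α := by
  unfold FA
  simp only [Consec_kd hk nd]
  constructor
  · rintro ⟨x, a, b, h1, h2, h3⟩; exact ⟨x, b, a, h2, h1, h3⟩
  · rintro ⟨x, a, b, h1, h2, h3⟩; exact ⟨x, b, a, h2, h1, h3⟩

lemma FR_kd (hk : Function.Injective k) (nd : ∀ a, s(a, a) ∉ S) {α β γ : Sym2 P} :
    FR (kd k) S α β γ ↔ FR k S γ β α := by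
  unfold FR
  simp only [Consec_kd hk nd]
  constructor
  · rintro ⟨x, y, a, c, h1, h2, h3, h4, h5⟩
    exact ⟨y, x, c, a, h3, by rw [h2, Sym2.eq_swap], h1, h5, h4⟩
  · rintro ⟨x, y, a, c, h1, h2, h3, h4, h5⟩
    exact ⟨y, x, c, a, h3, by rw [h2, Sym2.eq_swap], h1, h5, h4⟩

def gop (G : GPair V) : GPair V := ⟨fun x y => G.Arr y x, fun x y z => G.Rel z y x⟩

lemma EG.op (h : EG G) : EG (gop G) where
  rel h1 := (h.rel h1).symm
  irr := h.irr
  asym h1 h2 := h.asym h1 h2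
  out2 h1 h2 h3 := h.in2 h1 h2 h3
  in2 h1 h2 h3 := h.out2 h1 h2 h3
  nro h1 h2 h3 h4 h5 := h.nri h1 h2 h3 h4 h5
  nri h1 h2 h3 h4 h5 := h.nro h1 h2 h3 h4 h5
  ro h1 h2 := h.ri h1 h2
  ri h1 h2 := h.ro h1 h2

lemma NC_kd (hk : Function.Injective k) (h : NC k S) : NC (kd k) S :=
  ⟨h.nd, fun a b c d h1 h2 h3 => h.nc a d c b h1 (Sym2.eq_swap ▸ h2) ((Cyc4_kd hk).1 h3)⟩

lemma Realize.op (hk : Function.Injective k) {U : Set V} {f : V → Sym2 P}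
    (h : Realize k G U f) : Realize (kd k) (gop G) U f where
  nc := NC_kd hk h.nc
  inj := h.inj
  arr x hx y hy := by rw [FA_kd hk h.nc.nd]; exact h.arr y hy x hx
  rel x hx y hy z hz := by rw [FR_kd hk h.nc.nd]; exact h.rel z hz y hy x hx

lemma Realize.in_slot (hG : EG G) (hk : Function.Injective k) {U : Set V} {f : V → Sym2 P}
    (h : Realize k G U f) (hf : (f '' U).Finite) {w z : V} (hw : w ∈ U) (hz : z ∉ U) (hzw : G.Arr z w) :
    ∃ q b, f w = s(q, b) ∧ First k (f '' U) q b ∧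
      ∀ v ∈ U, (G.Rel z w v ↔ ∃ c, f v = s(b, c) ∧ Consec k (f '' U) b q c) := by
  obtain ⟨q, b, e, hl, hr⟩ := (h.op hk).out_slot hG.op (kd_inj hk) hf hw hz hzw
  refine ⟨q, b, e, (Last_kd hk h.nc.nd).1 hl, ?_⟩
  simp only [Consec_kd hk h.nc.nd] at hr
  exact hr

end Dual

section Leaf
variable {P K : Type*} [LinearOrder K] {k : P → K} {S : Set (Sym2 P)} {V : Type} {G : GPair V}

lemma NC_unkd (hk : Function.Injective k) (h : NC (kd k) S) : NC k S :=
  ⟨h.nd, fun a b c d h1 h2 h3 => h.nc a d c b h1 (Sym2.eq_swap ▸ h2) ((Cyc4_kd hk).2 h3)⟩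

lemma Realize.unop (hk : Function.Injective k) {U : Set V} {f : V → Sym2 P}
    (h : Realize (kd k) (gop G) U f) : Realize k G U f where
  nc := NC_unkd hk h.nc
  inj := h.inj
  arr x hx y hy := by rw [← FA_kd hk h.nc.nd]; exact h.arr y hy x hx
  rel x hx y hy z hz := by rw [← FR_kd hk h.nc.nd]; exact h.rel z hz y hy x hx

lemma Last.uniq (hk : Function.Injective k) {p a a' : P} (h : Last k S p a) (h' : Last k S p a') :
    a = a' := by
  by_contra hn
  rcases L_total hk p hn with h1 | h1
  · exact h.2 _ h'.1 h1
  · exact h'.2 _ h.1 h1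

/-- the data produced by `out_slot` -/
def OutSlot (k : P → K) (G : GPair V) (U : Set V) (f : V → Sym2 P) (y z : V) (p a : P) : Prop :=
  f y = s(p, a) ∧ Last k (f '' U) p a ∧
      ∀ x ∈ U, (G.Rel x y z ↔ ∃ a', f x = s(a, a') ∧ Consec k (f '' U) a a' p)

lemma OutSlot.h1 (hk : Function.Injective k) {U : Set V} {f : V → Sym2 P}
    (h : Realize k G U f) {y z : V} {p a : P} (hy : y ∈ U) (hyz : G.Arr y z)
    (hu : ∀ y' ∈ U, G.Arr y' z → y' = y) (hs : OutSlot k G U f y z p a) :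
    ∀ y ∈ U, (G.Arr y z ↔ ∃ a, f y = s(p, a) ∧ Last k (f '' U) p a) := by
  intro y' hy'
  constructor
  · intro h1
    rw [hu y' hy' h1]
    exact ⟨a, hs.1, hs.2.1⟩
  · rintro ⟨a', e, hl⟩
    rw [hl.uniq hk hs.2.1, ← hs.1] at e
    rwa [h.inj hy' hy e]

lemma OutSlot.h3 (hk : Function.Injective k) (hG : EG G) {U : Set V} {f : V → Sym2 P}
    (h : Realize k G U f) {y z : V} {p a : P} (hy : y ∈ U)
    (hu : ∀ y' ∈ U, G.Arr y' z → y' = y) (hs : OutSlot k G U f y z p a) :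
    ∀ x ∈ U, ∀ y ∈ U, (G.Rel x y z ↔ ∃ x' a, f x = s(x', a) ∧ f y = s(x', p) ∧
      Consec k (f '' U) x' a p ∧ Last k (f '' U) p x') := by
  intro x hx y' hy'
  constructor
  · intro h1
    obtain rfl := hu y' hy' (hG.rel h1).2
    obtain ⟨a', e, hc⟩ := (hs.2.2 x hx).1 h1
    exact ⟨a, a', e, by rw [hs.1, Sym2.eq_swap], hc, hs.2.1⟩
  · rintro ⟨x', a', e1, e2, hc, hl⟩
    have := hl.uniq hk hs.2.1
    subst this
    rw [Sym2.eq_swap, ← hs.1] at e2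
    obtain rfl := h.inj hy' hy e2
    exact (hs.2.2 x hx).2 ⟨a', e1, hc⟩

def InSlot (k : P → K) (G : GPair V) (U : Set V) (f : V → Sym2 P) (w z : V) (q b : P) : Prop :=
  f w = s(q, b) ∧ First k (f '' U) q b ∧
      ∀ v ∈ U, (G.Rel z w v ↔ ∃ c, f v = s(b, c) ∧ Consec k (f '' U) b q c)

lemma InSlot.op (hk : Function.Injective k) {U : Set V} {f : V → Sym2 P}
    (h : Realize k G U f) {w z : V} {q b : P} (hs : InSlot k G U f w z q b) :
    OutSlot (kd k) (gop G) U f w z q b := by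
  refine ⟨hs.1, (Last_kd hk h.nc.nd).2 hs.2.1, ?_⟩
  simp only [Consec_kd hk h.nc.nd]
  exact hs.2.2

lemma InSlot.h2 (hk : Function.Injective k) {U : Set V} {f : V → Sym2 P}
    (h : Realize k G U f) {w z : V} {q b : P} (hw : w ∈ U) (hzw : G.Arr z w)
    (hu : ∀ y' ∈ U, G.Arr z y' → y' = w) (hs : InSlot k G U f w z q b) :
    ∀ w ∈ U, (G.Arr z w ↔ ∃ a, f w = s(q, a) ∧ First k (f '' U) q a) := by
  have := OutSlot.h1 (kd_inj hk) (h.op hk) hw hzw hu (hs.op hk h)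
  simp only [Last_kd hk h.nc.nd] at this
  exact this

lemma InSlot.h4 (hk : Function.Injective k) (hG : EG G) {U : Set V} {f : V → Sym2 P}
    (h : Realize k G U f) {w z : V} {q b : P} (hw : w ∈ U)
    (hu : ∀ y' ∈ U, G.Arr z y' → y' = w) (hs : InSlot k G U f w z q b) :
    ∀ w ∈ U, ∀ v ∈ U, (G.Rel z w v ↔ ∃ y c, f w = s(q, y) ∧ f v = s(y, c) ∧
      First k (f '' U) q y ∧ Consec k (f '' U) y q c) := by
  have := OutSlot.h3 (kd_inj hk) hG.op (h.op hk) hw hu (hs.op hk h)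
  simp only [Last_kd hk h.nc.nd, Consec_kd hk h.nc.nd] at this
  intro w' hw' v hv
  refine (this v hv w' hw').trans ⟨?_, ?_⟩
  · rintro ⟨y, c, h1, h2, h3, h4⟩
    exact ⟨y, c, by rw [h2, Sym2.eq_swap], h1, h4, h3⟩
  · rintro ⟨y, c, h1, h2, h3, h4⟩
    exact ⟨y, c, h2, by rw [h1, Sym2.eq_swap], h4, h3⟩

/-- existence of a point just before a given one -/
def Fresh (k : P → K) : Prop :=
  ∀ (F : Set P), F.Finite → ∀ p, ∃ q, q ∉ F ∧ q ≠ p ∧ ∀ v ∈ F, v ≠ p → L k p v q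

lemma pts_finite (hf : S.Finite) : {v | ∃ c, s(v, c) ∈ S}.Finite := by
  have : {v | ∃ c, s(v, c) ∈ S} ⊆ ⋃ d ∈ S, {v | v ∈ d} := by
    rintro v ⟨c, hc⟩
    simp only [Set.mem_iUnion]
    exact ⟨_, hc, by simp⟩
  refine (hf.biUnion fun d _ => ?_).subset this
  induction d with | _ a b =>
  refine (Set.toFinite {a, b}).subset ?_
  intro v hv
  simpa using hv

lemma Realize.leaf_out (hF : Fresh k) (hG : EG G) (hk : Function.Injective k) {U : Set V}
    {f : V → Sym2 P} (h : Realize k G U f) (hf : (f '' U).Finite) {y z : V} (hy : y ∈ U)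
    (hz : z ∉ U) (hyz : G.Arr y z) (hu : ∀ y' ∈ U, G.Arr y' z → y' = y)
    (hu' : ∀ w ∈ U, ¬ G.Arr z w) : ∃ f', Realize k G (insert z U) f' := by
  classical
  obtain ⟨p, a, hs⟩ := h.out_slot hG hk hf hy hz hyz
  change OutSlot k G U f y z p a at hs
  obtain ⟨q, hq1, hq2, hq3⟩ := hF _ (pts_finite hf) p
  have hq1 : ∀ c, s(q, c) ∉ f '' U := fun c hc => hq1 ⟨c, hc⟩
  have hq3 : ∀ v c, s(v, c) ∈ f '' U → v ≠ p → L k p v q := fun v c hc => hq3 v ⟨c, hc⟩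
  refine ⟨_, h.extend (p := p) (q := q) hk hG hz ⟨hq2.symm, ?_, ?_⟩ ?_ (hs.h1 hk h hy hyz hu) ?_ (hs.h3 hk hG h hy hu)
    ?_ ?_⟩
  · intro c hc
    exact hq3 c p (Sym2.eq_swap ▸ hc) (ne_of_nd h.nc.nd hc)
  · intro c hc; exact absurd hc (hq1 c)
  · rintro c d hcd ⟨-, h1, h2⟩
    exact L_asymm h2 (hq3 d c (Sym2.eq_swap ▸ hcd) (L_ne_right h2))
  · intro w hw
    refine iff_of_false (hu' w hw) ?_
    rintro ⟨a, -, h1⟩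
    exact hq1 _ h1.1
  · intro w hw v hv
    refine iff_of_false (fun h => hu' w hw (hG.rel h).1) ?_
    rintro ⟨a, -, -, -, h1, -⟩
    exact hq1 _ h1.1
  · intro y hy w hw _ h1
    exact absurd h1 (hu' w hw)

lemma Realize.leaf_in (hF : Fresh (kd k)) (hG : EG G) (hk : Function.Injective k) {U : Set V}
    {f : V → Sym2 P} (h : Realize k G U f) (hf : (f '' U).Finite) {y z : V} (hy : y ∈ U)
    (hz : z ∉ U) (hyz : G.Arr z y) (hu : ∀ y' ∈ U, G.Arr z y' → y' = y)
    (hu' : ∀ w ∈ U, ¬ G.Arr w z) : ∃ f', Realize k G (insert z U) f' := by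
  obtain ⟨f', hf'⟩ := (h.op hk).leaf_out hF hG.op (kd_inj hk) hf hy hz hyz hu hu'
  exact ⟨f', hf'.unop hk⟩

end Leaf

lemma fresh_rat : Fresh (id : ℚ → ℚ) := by
  intro F hF p
  have h : ∀ᶠ q in nhdsWithin p (Set.Iio p), ∀ v ∈ F, v < p → v < q := by
    rw [Filter.eventually_all_finite hF]
    intro v _
    by_cases hv : v < p
    · filter_upwards [Ioo_mem_nhdsLT hv] with q hq _ using hq.1
    · exact Filter.Eventually.of_forall fun q h => absurd h hv
  obtain ⟨q, h1, h2⟩ := (h.and self_mem_nhdsWithin).exists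
  have h2 : q < p := h2
  refine ⟨q, fun hq => lt_irrefl _ (h1 q hq h2), h2.ne, fun v hv hvp => ?_⟩
  have := h1 v hv
  simp only [L, id]
  grind

lemma fresh_rat' : Fresh (kd (id : ℚ → ℚ)) := by
  intro F hF p
  have h : ∀ᶠ q in nhdsWithin p (Set.Ioi p), ∀ v ∈ F, p < v → q < v := by
    rw [Filter.eventually_all_finite hF]
    intro v _
    by_cases hv : p < v
    · filter_upwards [Ioo_mem_nhdsGT hv] with q hq _ using hq.2
    · exact Filter.Eventually.of_forall fun q h => absurd h hv
  obtain ⟨q, h1, h2⟩ := (h.and self_mem_nhdsWithin).exists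
  have h2 : p < q := h2
  refine ⟨q, fun hq => lt_irrefl _ (h1 q hq h2), h2.ne', fun v hv hvp => ?_⟩
  have := h1 v hv
  simp only [L, id, kd, OrderDual.toDual_le_toDual, OrderDual.toDual_lt_toDual]
  grind

section Poly
variable {P K : Type*} [LinearOrder K] {k : P → K} {S : Set (Sym2 P)} {V : Type} {G : GPair V}

structure PS (k : P → K) (S : Set (Sym2 P)) (q b s t : P) : Prop where
  ne : t ≠ q
  nc : ∀ c d, s(c, d) ∈ S → ¬ Cyc4 k q c t d
  pos : (s = q ∧ t = b) ∨ (L k q t b ∧ L k t s q)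
  inv : ∀ c, s(t, c) ∈ S → L k t s c → L k t q c

lemma PS.start (hS : NC k S) {q b : P} (h : First k S q b) : PS k S q b q b :=
  ⟨ne_of_nd hS.nd h.1, fun c d hc => hS.nc q c b d h.1 hc, Or.inl ⟨rfl, rfl⟩, fun _ _ h => h⟩

lemma PS.step (hk : Function.Injective k) (hS : NC k S) {q b s t t' : P} (hb : First k S q b)
    (h : PS k S q b s t) (hc : Consec k S t s t') : PS k S q b t t' ∧ L k q t' b ∧ L k t' t q := by
  have hqt := h.ne
  have hne : t' ≠ q := by
    rintro rfl
    rcases h.pos with ⟨rfl, rfl⟩ | ⟨h1, h2⟩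
    · exact hc.ne rfl
    · exact hb.2 t (Sym2.eq_swap ▸ hc.2.1) h1
  have hL : L k t q t' := h.inv _ hc.2.1 hc.2.2.1
  have hL1 : L k q t' t := L_rot hk hL hqt.symm
  have hL2 : L k t' t q := L_rot hk hL1 hne
  have hL3 : L k q t' b := by
    rcases h.pos with ⟨rfl, rfl⟩ | ⟨h1, h2⟩
    · exact hL1
    · exact L_trans hL1 h1
  have i := fun u v => hk.eq_iff (a := u) (b := v)
  refine ⟨⟨hne, ?_, Or.inr ⟨hL3, hL2⟩, ?_⟩, hL3, hL2⟩
  · intro c d hcd hx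
    have hdt : d = t := by
      have n1 := h.nc c d hcd
      have n2 := hS.nc t c t' d hc.2.1 hcd
      have n3 := hS.nc t d t' c hc.2.1 (Sym2.eq_swap ▸ hcd)
      clear hcd hc hb h
      simp only [Cyc4, L, Ne, ← i] at *
      grind
    subst hdt
    have hcq : L k d q c ∧ L k d c t' := by
      clear hcd hc hb h
      simp only [Cyc4, L, Ne, ← i] at *
      grind
    refine hc.2.2.2 c (Sym2.eq_swap ▸ hcd) ⟨?_, hcq.2⟩
    rcases h.pos with ⟨rfl, rfl⟩ | ⟨h1, h2⟩
    · exact hcq.1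
    · exact L_trans h2 hcq.1
  · intro c hcS hL4
    have hcq : c ≠ q := by
      rintro rfl
      exact hb.2 t' (Sym2.eq_swap ▸ hcS) hL3
    rcases L_total hk t' hcq with h1 | h1
    · exfalso
      refine h.nc t' c hcS ?_
      clear hcS hc hb h
      simp only [Cyc4, L, Ne, ← i] at *
      grind
    · exact h1

lemma Realize.poly (hk : Function.Injective k) {U : Set V} {f : V → Sym2 P}
    (h : Realize k G U f) {y w z : V} {p a q b : P} (hi : InSlot k G U f w z q b)
    (ho : OutSlot k G U f y z p a) {n : ℕ} (hn : 1 ≤ n) (u : ℕ → V) (hU : ∀ i, i ≤ n → u i ∈ U)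
    (h0 : u 0 = w) (hun : u n = y)
    (hrel : ∀ i, i + 2 ≤ n → G.Rel (u i) (u (i + 1)) (u (i + 2)))
    (hr0 : G.Rel z w (u 1)) (hr1 : G.Rel (u (n - 1)) y z) :
    Ins k (f '' U) p q ∧ ∀ c d, s(c, d) ∈ f '' U → ¬ Cyc4 k p c q d := by
  have main : ∀ i, i + 1 ≤ n → ∃ s t r, f (u (i + 1)) = s(s, t) ∧ f (u i) = s(s, r) ∧
      Consec k (f '' U) s r t ∧ PS k (f '' U) q b s t ∧ L k q t b ∧ L k t s q := by
    intro i
    induction i with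
    | zero =>
      intro _
      obtain ⟨c, e, hc⟩ := (hi.2.2 _ (hU 1 hn)).1 hr0
      exact ⟨b, c, q, e, by rw [h0, hi.1, Sym2.eq_swap], hc, PS.step hk h.nc hi.2.1 (PS.start h.nc hi.2.1) hc⟩
    | succ i ih =>
      intro hin
      obtain ⟨s, t, r, e1, e2, hc, hp, -⟩ := ih (by omega)
      have hr := hrel i hin
      rw [h.rel _ (hU _ (by omega)) _ (hU _ (by omega)) _ (hU _ (by omega)), e1, e2, FR_iff hc] at hr
      obtain ⟨c, e3, hc'⟩ := hr
      exact ⟨t, c, s, e3, by rw [e1, Sym2.eq_swap], hc', PS.step hk h.nc hi.2.1 hp hc'⟩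
  obtain ⟨s, t, r, e1, e2, hc, hp, hL1, hL2⟩ := main (n - 1) (by omega)
  rw [show n - 1 + 1 = n by omega, hun] at e1
  obtain ⟨a', e3, hc'⟩ := (ho.2.2 _ (hU (n - 1) (by omega))).1 hr1
  have e4 := ho.1
  rw [e2] at e3
  rw [e1, Sym2.eq_swap (a := p)] at e4
  obtain ⟨rfl, rfl, rfl⟩ := chord_meet hc.ne e3 e4
  refine ⟨⟨hp.ne, ?_, ?_⟩, ?_⟩
  · intro c hc1
    by_cases hca : c = a
    · rw [hca]; exact hL2
    · rcases L_total hk p hca with h1 | h1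
      · exact L_trans h1 hL2
      · exact absurd h1 (ho.2.1.2 c hc1)
  · intro c hc1
    by_cases hca : c = b
    · rw [hca]; exact hL1
    · rcases L_total hk q hca with h1 | h1
      · exact absurd h1 (hi.2.1.2 c hc1)
      · exact L_trans hL1 h1
  · intro c d hcd hx
    refine hp.nc d c (Sym2.eq_swap ▸ hcd) ?_
    have i := fun u v => hk.eq_iff (a := u) (b := v)
    simp only [Cyc4, L, Ne, ← i] at *
    grind

end Poly

section Path
variable {V : Type} {G : GPair V}

def resG (G : GPair V) (U : Set V) : SimpleGraph V :=
  SimpleGraph.fromRel (fun a b => G.Arr a b ∧ a ∈ U ∧ b ∈ U)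

lemma resG_adj {U : Set V} {a b : V} (h : (resG G U).Adj a b) :
    a ∈ U ∧ b ∈ U ∧ (G.Arr a b ∨ G.Arr b a) := by
  rw [resG, SimpleGraph.fromRel_adj] at h
  tauto

def UConn (G : GPair V) (U : Set V) : Prop := ∀ a ∈ U, ∀ b ∈ U, (resG G U).Reachable a b

def PolyPath (G : GPair V) (U : Set V) (z w y : V) : Prop :=
  ∃ n : ℕ, 1 ≤ n ∧ ∃ u : ℕ → V, (∀ i, i ≤ n → u i ∈ U) ∧ u 0 = w ∧ u n = y ∧
    (∀ i, i + 2 ≤ n → G.Rel (u i) (u (i + 1)) (u (i + 2))) ∧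
    G.Rel z w (u 1) ∧ G.Rel (u (n - 1)) y z

lemma cycle_path (hC : G.CyclesOrientedFull) {U : Set V} (hU : UConn G U)
    {z y1 y2 : V} (hz : z ∉ U) (h1 : y1 ∈ U) (h2 : y2 ∈ U) (hne : y1 ≠ y2)
    (a1 : G.Arr y1 z ∨ G.Arr z y1) (a2 : G.Arr y2 z ∨ G.Arr z y2) :
    (G.Arr y2 z ∧ G.Arr z y1 ∧ PolyPath G U z y1 y2 ∧ G.Rel y2 z y1) ∨ (G.Arr y1 z ∧ G.Arr z y2) := by
  classical
  obtain ⟨p, hp⟩ := (hU y1 h1 y2 h2).exists_isPath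
  set n := p.length with hn
  set u := p.getVert with hu
  have u0 : u 0 = y1 := p.getVert_zero
  have un : u n = y2 := p.getVert_length
  have hn1 : 1 ≤ n := by
    by_contra h
    have : n = 0 := by omega
    rw [this, u0] at un
    exact hne un
  have hadj : ∀ i, i < n → (resG G U).Adj (u i) (u (i + 1)) := fun i hi => p.adj_getVert_succ hi
  have hmem : ∀ i, i ≤ n → u i ∈ U := by
    intro i hi
    rcases hi.lt_or_eq with h | h
    · exact (resG_adj (hadj i h)).1
    · rw [h, un]; exact h2
  have hinj : ∀ i j, i ≤ n → j ≤ n → u i = u j → i = j := by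
    intro i j hi hj e
    exact hp.getVert_injOn hi hj e
  let v : ZMod (n + 2) → V := fun j => if j.val ≤ n then u j.val else z
  have hval : ∀ i, i ≤ n + 1 → ((i : ℕ) : ZMod (n + 2)).val = i := fun i hi =>
    ZMod.val_cast_of_lt (by omega)
  have v1 : ∀ i : ℕ, i ≤ n → v i = u i := by
    intro i hi
    simp only [v, hval i (by omega), if_pos hi]
  have v2 : v ((n + 1 : ℕ) : ZMod (n + 2)) = z := by
    simp only [v, hval (n + 1) le_rfl]
    rw [if_neg (by omega)]
  have v3 : v ((n + 2 : ℕ) : ZMod (n + 2)) = y1 := by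
    rw [ZMod.natCast_self]
    have := v1 0 (by omega)
    simpa [u0] using this
  have v4 : v ((n + 3 : ℕ) : ZMod (n + 2)) = u 1 := by
    have : ((n + 3 : ℕ) : ZMod (n + 2)) = ((1 : ℕ) : ZMod (n + 2)) := by
      have := ZMod.natCast_self (n + 2)
      push_cast at *
      linear_combination this
    rw [this, v1 1 hn1]
  have vinj : Function.Injective v := by
    intro i j e
    apply ZMod.val_injective
    have hi := ZMod.val_lt i
    have hj := ZMod.val_lt j
    simp only [v] at e
    split_ifs at e with c1 c2 c2
    · exact hinj _ _ c1 c2 e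
    · exact absurd (e ▸ hmem _ c1) hz
    · exact absurd (e ▸ hmem _ c2) hz
    · omega
  have hall : ∀ Q : ZMod (n + 2) → Prop, (∀ i : ℕ, i ≤ n + 1 → Q i) → ∀ i, Q i := by
    intro Q hQ i
    have := hQ i.val (by have := ZMod.val_lt i; omega)
    rwa [ZMod.natCast_zmod_val] at this
  have hcyc : G.UndirCycle (n + 2) v := by
    refine ⟨by omega, vinj, hall _ ?_⟩
    intro i hi
    have e : ((i : ℕ) : ZMod (n + 2)) + 1 = ((i + 1 : ℕ) : ZMod (n + 2)) := by push_cast; rfl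
    rw [e]
    rcases (show i < n ∨ i = n ∨ i = n + 1 by omega) with h | rfl | rfl
    · rw [v1 i h.le, v1 (i + 1) h]
      exact (resG_adj (hadj i h)).2.2
    · rw [v1 _ le_rfl, v2, un]; exact a2
    · rw [v2, v3]; exact a1.symm
  have e1 : ∀ i : ℕ, ((i : ℕ) : ZMod (n + 2)) + 1 = ((i + 1 : ℕ) : ZMod (n + 2)) := by
    intro i; push_cast; rfl
  have e2 : ∀ i : ℕ, ((i : ℕ) : ZMod (n + 2)) + 2 = ((i + 2 : ℕ) : ZMod (n + 2)) := by
    intro i; push_cast; rfl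
  rcases hC.1 _ _ hcyc with hf | hb
  · left
    have hR := hC.2 _ v ⟨hcyc.1, vinj, hf⟩
    have f1 := fun i : ℕ => hf i
    have f2 := fun i : ℕ => hR i
    simp only [e1, e2] at f1 f2
    refine ⟨?_, ?_, ⟨n, hn1, u, hmem, u0, un, ?_, ?_, ?_⟩, ?_⟩
    · have := f1 n
      rwa [v2, v1 n le_rfl, un] at this
    · have := f1 (n + 1)
      rwa [v2, v3] at this
    · intro i hi
      have := f2 i
      rwa [v1 i (by omega), v1 (i + 1) (by omega), v1 (i + 2) hi] at this
    · have := f2 (n + 1)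
      rwa [v2, v3, v4] at this
    · have := f2 (n - 1)
      rwa [v1 (n - 1) (by omega), show n - 1 + 1 = n by omega, show n - 1 + 2 = n + 1 by omega, v2,
        v1 n le_rfl, un] at this
    · have := f2 n
      rwa [v1 n le_rfl, v2, v3, un] at this
  · right
    have f1 := fun i : ℕ => hb i
    simp only [e1] at f1
    constructor
    · have := f1 (n + 1)
      rwa [v2, v3] at this
    · have := f1 n
      rwa [v2, v1 n le_rfl, un] at this

lemma resG_mono {U U' : Set V} (h : U ⊆ U') : resG G U ≤ resG G U' := by
  intro a b
  simp only [resG, SimpleGraph.fromRel_adj]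
  rintro ⟨h0, ⟨h1, h2, h3⟩ | ⟨h1, h2, h3⟩⟩
  · exact ⟨h0, Or.inl ⟨h1, h h2, h h3⟩⟩
  · exact ⟨h0, Or.inr ⟨h1, h h2, h h3⟩⟩

lemma UConn.insert (hU : UConn G U) {y z : V} (hy : y ∈ U) (hz : z ∉ U)
    (ha : G.Arr y z ∨ G.Arr z y) : UConn G (insert z U) := by
  have hzy : (resG G (Insert.insert z U)).Reachable z y := by
    refine SimpleGraph.Adj.reachable ?_
    rw [resG, SimpleGraph.fromRel_adj]
    refine ⟨fun e => hz (e ▸ hy), ?_⟩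
    simp only [Set.mem_insert_iff, true_or, hy, or_true, and_true]
    exact ha.symm
  have hb : ∀ b ∈ Insert.insert z U, (resG G (Insert.insert z U)).Reachable y b := by
    rintro b (rfl | hb)
    · exact hzy.symm
    · exact (hU y hy b hb).mono (resG_mono (Set.subset_insert _ _))
  intro a ha b hb'
  exact (hb a ha).symm.trans (hb b hb')

end Path

lemma grow {V : Type} {G : GPair V} (hG : EG G) (hC : G.CyclesOrientedFull) {U : Set V}
    (hfin : U.Finite) (hU : UConn G U) {f : V → Sym2 ℚ} (h : Realize (id : ℚ → ℚ) G U f) {y z : V}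
    (hy : y ∈ U) (hz : z ∉ U) (ha : G.Arr y z ∨ G.Arr z y) :
    ∃ f', Realize (id : ℚ → ℚ) G (insert z U) f' := by
  classical
  have hk : Function.Injective (id : ℚ → ℚ) := Function.injective_id
  have hf : (f '' U).Finite := hfin.image f
  have uin : ∀ y1 ∈ U, ∀ y2 ∈ U, G.Arr y1 z → G.Arr y2 z → y1 = y2 := by
    intro y1 h1 y2 h2 a1 a2
    by_contra hne
    rcases cycle_path hC hU hz h1 h2 hne (Or.inl a1) (Or.inl a2) with h | h
    · exact hG.asym a1 h.2.1
    · exact hG.asym a2 h.2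
  have uout : ∀ y1 ∈ U, ∀ y2 ∈ U, G.Arr z y1 → G.Arr z y2 → y1 = y2 := by
    intro y1 h1 y2 h2 a1 a2
    by_contra hne
    rcases cycle_path hC hU hz h1 h2 hne (Or.inr a1) (Or.inr a2) with h | h
    · exact hG.asym a2 h.1
    · exact hG.asym a1 h.1
  by_cases c1 : ∃ y ∈ U, G.Arr y z
  · obtain ⟨y, hy, hyz⟩ := c1
    by_cases c2 : ∃ w ∈ U, G.Arr z w
    · obtain ⟨w, hw, hzw⟩ := c2
      have hwy : w ≠ y := by rintro rfl; exact hG.asym hyz hzw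
      rcases cycle_path hC hU hz hw hy hwy (Or.inr hzw) (Or.inl hyz) with ⟨-, -, hp, hr⟩ | h'
      · obtain ⟨p, a, ho⟩ := h.out_slot hG hk hf hy hz hyz
        obtain ⟨q, b, hi⟩ := h.in_slot hG hk hf hw hz hzw
        change OutSlot id G U f y z p a at ho
        change InSlot id G U f w z q b at hi
        obtain ⟨n, hn, u, hu, h0, hun, hrel, hr0, hr1⟩ := hp
        obtain ⟨g1, g2⟩ := h.poly hk hi ho hn u hu h0 hun hrel hr0 hr1
        refine ⟨_, h.extend hk hG hz g1 g2 (ho.h1 hk h hy hyz fun y' hy' ha => uin _ hy' _ hy ha hyz)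
          (hi.h2 hk h hw hzw fun y' hy' ha => uout _ hy' _ hw ha hzw)
          (ho.h3 hk hG h hy fun y' hy' ha => uin _ hy' _ hy ha hyz)
          (hi.h4 hk hG h hw fun y' hy' ha => uout _ hy' _ hw ha hzw) ?_⟩
        intro y' hy' w' hw' a1 a2
        rw [uin _ hy' _ hy a1 hyz, uout _ hw' _ hw a2 hzw]
        exact hr
      · exact absurd h'.1 (hG.asym hzw)
    · push Not at c2
      exact h.leaf_out fresh_rat hG hk hf hy hz hyz (fun y' hy' ha => uin _ hy' _ hy ha hyz) c2
  · push Not at c1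
    have hzy : G.Arr z y := ha.resolve_left (c1 y hy)
    exact h.leaf_in fresh_rat' hG hk hf hy hz hzy (fun y' hy' ha => uout _ hy' _ hy ha hzy) c1

lemma realize_single {V : Type} {G : GPair V} (hG : EG G) (v : V) :
    Realize (id : ℚ → ℚ) G {v} (fun _ => s(0, 1)) := by
  have nf : ∀ x a b, ¬ Consec (id : ℚ → ℚ) {s(0, 1)} x a b := by
    rintro x a b ⟨h1, h2, h3, -⟩
    rw [Set.mem_singleton_iff] at h1 h2
    rw [← h2] at h1
    rw [Sym2.congr_right.1 h1] at h3
    exact L_irr h3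
  refine ⟨?_, ?_, ?_, ?_⟩
  · simp only [Set.image_singleton]
    constructor
    · intro a ha
      rw [Set.mem_singleton_iff, Sym2.eq_iff] at ha
      grind
    · intro a b c d h1 h2 h3
      rw [Set.mem_singleton_iff, Sym2.eq_iff] at h1 h2
      simp only [Cyc4, L, id] at h3
      grind
  · simp
  · rintro x rfl y rfl
    exact iff_of_false (hG.irr _) (FA_irr _)
  · rintro x rfl y rfl z rfl
    exact iff_of_false (fun h => hG.irr _ (hG.rel h).1) (fun h => FA_irr _ (FR_FA h).1)

lemma realize_univ {V : Type} [Finite V] {G : GPair V} (hG : EG G) (hC : G.CyclesOrientedFull)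
    (hc : G.Conn) : ∃ f, Realize (id : ℚ → ℚ) G Set.univ f := by
  classical
  obtain ⟨v0⟩ := hc.nonempty
  have main : ∀ n : ℕ, n + 1 ≤ Nat.card V → ∃ U : Set V, U.ncard = n + 1 ∧ v0 ∈ U ∧ UConn G U ∧
      ∃ f, Realize (id : ℚ → ℚ) G U f := by
    intro n
    induction n with
    | zero =>
      intro _
      refine ⟨{v0}, by simp, by simp, ?_, _, realize_single hG v0⟩
      rintro a rfl b rfl
      exact SimpleGraph.Reachable.refl _
    | succ n ih =>
      intro hn
      obtain ⟨U, hU1, hU2, hU3, f, hf⟩ := ih (by omega)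
      obtain ⟨v1, hv1⟩ : ∃ v, v ∉ U := by
        by_contra! hh
        rw [Set.eq_univ_of_forall hh, Set.ncard_univ] at hU1
        omega
      obtain ⟨p⟩ := hc.preconnected v0 v1
      obtain ⟨d, -, hd1, hd2⟩ := p.exists_boundary_dart U hU2 hv1
      have hd := d.adj
      rw [SimpleGraph.fromRel_adj] at hd
      obtain ⟨f', hf'⟩ := grow hG hC (Set.toFinite U) hU3 hf hd1 hd2 hd.2
      exact ⟨insert d.snd U, by rw [Set.ncard_insert_of_notMem hd2, hU1], Or.inr hU2,
        hU3.insert hd1 hd2 hd.2, f', hf'⟩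
  have hpos : 0 < Nat.card V := by
    have : Nonempty V := ⟨v0⟩
    exact Nat.card_pos
  obtain ⟨U, hU1, -, -, f, hf⟩ := main (Nat.card V - 1) (by omega)
  have : U = Set.univ := by
    refine Set.eq_of_subset_of_ncard_le (Set.subset_univ _) ?_
    rw [Set.ncard_univ]; omega
  exact ⟨f, this ▸ hf⟩

section Transfer
variable {P K P' K' : Type*} [LinearOrder K] [LinearOrder K'] {k : P → K} {k' : P' → K'}
  {S : Set (Sym2 P)} {g : P → P'} {T : Set P}

structure Tr (k : P → K) (k' : P' → K') (S : Set (Sym2 P)) (g : P → P') (T : Set P) : Prop where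
  mem : ∀ a b, s(a, b) ∈ S → a ∈ T
  lt : ∀ x ∈ T, ∀ y ∈ T, (k' (g x) < k' (g y) ↔ k x < k y)
  inj : Set.InjOn g T

namespace Tr

lemma L_iff (h : Tr k k' S g T) {x a b : P} (hx : x ∈ T) (ha : a ∈ T) (hb : b ∈ T) :
    L k' (g x) (g a) (g b) ↔ L k x a b := by
  unfold L
  simp only [← not_lt, h.lt _ hx _ ha, h.lt _ hx _ hb, h.lt _ ha _ hx, h.lt _ ha _ hb, h.lt _ hb _ hx,
    h.lt _ hb _ ha]

lemma mem' (h : Tr k k' S g T) {a b : P} (hab : s(a, b) ∈ S) : b ∈ T := h.mem b a (Sym2.eq_swap ▸ hab)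

lemma exi (h : Tr k k' S g T) {u v : P'} (huv : s(u, v) ∈ Sym2.map g '' S) :
    ∃ a b, s(a, b) ∈ S ∧ a ∈ T ∧ b ∈ T ∧ u = g a ∧ v = g b := by
  obtain ⟨d, hd, e⟩ := huv
  induction d with | _ a b =>
  rw [Sym2.map_mk] at e
  rcases Sym2.eq_iff.1 e with ⟨rfl, rfl⟩ | ⟨rfl, rfl⟩
  · exact ⟨a, b, hd, h.mem _ _ hd, h.mem' hd, rfl, rfl⟩
  · exact ⟨b, a, Sym2.eq_swap ▸ hd, h.mem' hd, h.mem _ _ hd, rfl, rfl⟩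

lemma mem_iff (h : Tr k k' S g T) {a b : P} (ha : a ∈ T) (hb : b ∈ T) :
    s(g a, g b) ∈ Sym2.map g '' S ↔ s(a, b) ∈ S := by
  constructor
  · intro hab
    obtain ⟨c, d, hcd, hc, hd, e1, e2⟩ := h.exi hab
    rwa [h.inj ha hc e1, h.inj hb hd e2]
  · intro hab
    exact ⟨_, hab, by rw [Sym2.map_mk]⟩

lemma consec_iff (h : Tr k k' S g T) {x a b : P} (hx : x ∈ T) (ha : a ∈ T) (hb : b ∈ T) :
    Consec k' (Sym2.map g '' S) (g x) (g a) (g b) ↔ Consec k S x a b := by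
  unfold Consec
  rw [h.mem_iff hx ha, h.mem_iff hx hb, h.L_iff hx ha hb]
  refine and_congr_right fun _ => and_congr_right fun _ => and_congr_right fun _ => ?_
  constructor
  · intro h1 c hc
    have hcT := h.mem' hc
    rw [← h.L_iff hx ha hcT, ← h.L_iff hx hcT hb]
    exact h1 _ ((h.mem_iff hx hcT).2 hc)
  · intro h1 c' hc'
    obtain ⟨x', c, hcd, hx', hcT, e1, rfl⟩ := h.exi hc'
    obtain rfl := h.inj hx hx' e1
    rw [h.L_iff hx ha hcT, h.L_iff hx hcT hb]
    exact h1 _ hcd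

lemma nc (h : Tr k k' S g T) (hS : NC k S) : NC k' (Sym2.map g '' S) := by
  constructor
  · intro u hu
    obtain ⟨a, b, hab, ha, hb, e1, e2⟩ := h.exi hu
    obtain rfl := h.inj ha hb (e1.symm.trans e2)
    exact hS.nd _ hab
  · intro a' b' c' d' h1 h2 h3
    obtain ⟨a, c, hac, ha, hc, rfl, rfl⟩ := h.exi h1
    obtain ⟨b, d, hbd, hb, hd, rfl, rfl⟩ := h.exi h2
    refine hS.nc a b c d hac hbd ⟨fun e => h3.1 (by rw [e]), ?_, ?_⟩
    · exact (h.L_iff ha hb hc).1 h3.2.1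
    · exact (h.L_iff ha hc hd).1 h3.2.2

lemma map_eq (h : Tr k k' S g T) {x a : P} {α : Sym2 P} (hα : α ∈ S) (hx : x ∈ T) (ha : a ∈ T)
    (e : Sym2.map g α = s(g x, g a)) : α = s(x, a) := by
  induction α with | _ c d =>
  rw [Sym2.map_mk] at e
  have hc := h.mem _ _ hα
  have hd := h.mem' hα
  rcases Sym2.eq_iff.1 e with ⟨e1, e2⟩ | ⟨e1, e2⟩
  · rw [h.inj hc hx e1, h.inj hd ha e2]
  · rw [h.inj hc ha e1, h.inj hd hx e2, Sym2.eq_swap]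

lemma fa_iff (h : Tr k k' S g T) {α β : Sym2 P} (hα : α ∈ S) (hβ : β ∈ S) :
    FA k' (Sym2.map g '' S) (Sym2.map g α) (Sym2.map g β) ↔ FA k S α β := by
  constructor
  · rintro ⟨x', a', b', e1, e2, hc⟩
    obtain ⟨x, a, hxa, hx, ha, rfl, rfl⟩ := h.exi hc.1
    obtain ⟨x2, b, hxb, hx2, hb, ex, rfl⟩ := h.exi hc.2.1
    exact ⟨x, a, b, h.map_eq hα hx ha e1, h.map_eq hβ hx hb e2, (h.consec_iff hx ha hb).1 hc⟩
  · rintro ⟨x, a, b, rfl, rfl, hc⟩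
    exact ⟨g x, g a, g b, by rw [Sym2.map_mk], by rw [Sym2.map_mk],
      (h.consec_iff (h.mem _ _ hα) (h.mem' hα) (h.mem' hβ)).2 hc⟩

lemma fr_iff (h : Tr k k' S g T) {α β γ : Sym2 P} (hα : α ∈ S) (hβ : β ∈ S) (hγ : γ ∈ S) :
    FR k' (Sym2.map g '' S) (Sym2.map g α) (Sym2.map g β) (Sym2.map g γ) ↔ FR k S α β γ := by
  constructor
  · rintro ⟨x', y', a', c', e1, e2, e3, h1, h2⟩
    obtain ⟨x, a, hxa, hx, ha, rfl, rfl⟩ := h.exi h1.1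
    obtain ⟨y, c, hyc, hy, hcT, rfl, rfl⟩ := h.exi h2.2.1
    exact ⟨x, y, a, c, h.map_eq hα hx ha e1, h.map_eq hβ hx hy e2, h.map_eq hγ hy hcT e3,
      (h.consec_iff hx ha hy).1 h1, (h.consec_iff hy hx hcT).1 h2⟩
  · rintro ⟨x, y, a, c, rfl, rfl, rfl, h1, h2⟩
    exact ⟨g x, g y, g a, g c, by rw [Sym2.map_mk], by rw [Sym2.map_mk], by rw [Sym2.map_mk],
      (h.consec_iff (h.mem _ _ hα) (h.mem' hα) (h.mem' hβ)).2 h1,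
      (h.consec_iff (h.mem' hβ) (h.mem _ _ hβ) (h.mem' hγ)).2 h2⟩

lemma map_inj (h : Tr k k' S g T) {α β : Sym2 P} (hα : α ∈ S) (hβ : β ∈ S)
    (e : Sym2.map g α = Sym2.map g β) : α = β := by
  induction β with | _ x a =>
  exact h.map_eq hα (h.mem _ _ hβ) (h.mem' hβ) e

end Tr
end Transfer

lemma part_b_fwd {V : Type} [Finite V] {G : GPair V} (hc : G.Conn)
    (h : G.IsGentle ∧ G.CyclesOrientedFull) : ∃ (M : ℕ), 2 ≤ M ∧ ∃ S : Set (Sym2 (ZMod M)),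
      IsTiling S ∧ G.Iso (tilingPair S) := by
  classical
  obtain ⟨f, hf⟩ := realize_univ ((gentle_iff G).1 h.1) h.2 hc
  have hfin : (f '' Set.univ).Finite := Set.toFinite _
  have hT := pts_finite hfin
  set F := hT.toFinset with hF
  let rk : ℚ → ℕ := fun x => (F.filter (· < x)).card
  have rkle : ∀ x, rk x ≤ F.card := fun x => Finset.card_filter_le _ _
  let g : ℚ → ZMod (F.card + 2) := fun x => ((rk x : ℕ) : ZMod (F.card + 2))
  have hg : ∀ x, kp (0 : ZMod (F.card + 2)) (g x) = rk x := by
    intro x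
    simp only [kp, sub_zero, g]
    exact ZMod.val_cast_of_lt (by have := rkle x; omega)
  have mono : ∀ x ∈ F, ∀ y, x < y → rk x < rk y := by
    intro x hx y hxy
    refine Finset.card_lt_card ?_
    rw [Finset.ssubset_iff_of_subset]
    · exact ⟨x, by simp [hx, hxy], by simp⟩
    · intro v
      simp only [Finset.mem_filter]
      exact fun h => ⟨h.1, h.2.trans hxy⟩
  have tr : Tr (id : ℚ → ℚ) (kp (0 : ZMod (F.card + 2))) (f '' Set.univ) g (F : Set ℚ) := by
    refine ⟨?_, ?_, ?_⟩
    · intro a b hab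
      simp only [hF, Set.Finite.coe_toFinset]
      exact ⟨b, hab⟩
    · intro x hx y hy
      rw [hg, hg]
      constructor
      · intro h1
        by_contra h2
        rcases (not_lt.1 h2).lt_or_eq with h3 | h3
        · have := mono y hy x h3
          omega
        · simp only [id] at h3
          rw [h3] at h1; omega
      · exact fun h1 => mono x hx y h1
    · intro x hx y hy e
      have e' : rk x = rk y := by rw [← hg, ← hg, e]
      rcases lt_trichotomy x y with h3 | h3 | h3
      · have := mono x hx y h3; omega
      · exact h3
      · have := mono y hy x h3; omega
  have hS := tr.nc hf.nc
  have m : ∀ v, f v ∈ f '' Set.univ := fun v => ⟨v, trivial, rfl⟩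
  refine ⟨F.card + 2, by omega, _, (tiling_NC 0 _).2 hS, ?_⟩
  let e0 : V → {d // d ∈ Sym2.map g '' (f '' Set.univ)} := fun v => ⟨Sym2.map g (f v), _, m v, rfl⟩
  have he : Function.Bijective e0 := by
    constructor
    · intro x y hxy
      exact hf.inj trivial trivial (tr.map_inj (m x) (m y) (congrArg Subtype.val hxy))
    · rintro ⟨_, _, ⟨v, -, rfl⟩, rfl⟩
      exact ⟨v, rfl⟩
  refine ⟨Equiv.ofBijective e0 he, ?_, ?_⟩
  · intro x y
    rw [hf.arr x trivial y trivial, ← tr.fa_iff (m x) (m y)]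
    exact (QArr_iff 0 hS _ _).symm
  · intro x y z
    rw [hf.rel x trivial y trivial z trivial, ← tr.fr_iff (m x) (m y) (m z)]
    exact (QRel_iff 0 hS _ _ _).symm

/-- Proposition 3.3. (a) For every tiling `S` of a disc with `M ≥ 2`
marked points, the pair `(Q_S, R_S)` is gentle with all cycles oriented and relation-full.
(b) A connected pair `(Q,R)` is isomorphic to `(Q_S, R_S)` for some tiling `S` if and only
if it is a gentle pair all of whose cycles are oriented and relation-full. -/
theorem tiling_iff_gentle :
    (∀ (M : ℕ), 2 ≤ M → ∀ S : Set (Sym2 (ZMod M)), IsTiling S →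
      (tilingPair S).IsGentle ∧ (tilingPair S).CyclesOrientedFull) ∧
    (∀ (V : Type), Finite V → ∀ G : GPair V, G.Conn →
      ((G.IsGentle ∧ G.CyclesOrientedFull) ↔
        ∃ (M : ℕ), 2 ≤ M ∧ ∃ S : Set (Sym2 (ZMod M)), IsTiling S ∧
          G.Iso (tilingPair S))) := by
  refine ⟨part_a, fun V hV G hc => ⟨fun h => ?_, part_b_rev⟩⟩
  haveI := hV
  exact part_b_fwd hc h
end PaperTiling
end

section
/- Let S be a tiling of a disc with marked points such that the quiver Q_S is connected. (1) If S contains at least two diagonals, then the permitted threads of (Q_S, R_S) are in bijection with the non-isolated marked points: each non-isolated marked point v corresponds to the permitted thread formed by the successive arrows between consecutive diagonals of the fan at v (the diagonals of S incident with v, taken in clockwise order around v). (2) If S contains exactly one diagonal, then (Q_S, R_S) has a unique permitted thread, which is trivial, and both endpoints of the diagonal correspond to it. (3) A permitted thread of (Q_S, R_S) is trivial if and only if the corresponding marked point lies on exactly one diagonal of S. -/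
namespace PaperTiling

variable {M : ℕ}

theorem cnt_pos' (p a : ZMod M) : 1 ≤ cnt p a := by unfold cnt; omega

theorem cnt_le [NeZero M] (p a : ZMod M) : cnt p a ≤ M := by
  have := ZMod.val_lt (a - p); unfold cnt; omega

theorem cnt_self (p : ZMod M) : cnt p p = 1 := by simp [cnt]

theorem cnt_inj [NeZero M] {p a b : ZMod M} (h : cnt p a = cnt p b) : a = b := by
  have h' : (a - p).val = (b - p).val := by unfold cnt at h; omega
  have := ZMod.val_injective M h'
  exact sub_left_injective this

theorem cnt_eq [NeZero M] (p a b : ZMod M) :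
    (cnt p a ≤ cnt p b ∧ cnt a b + cnt p a = cnt p b + 1) ∨
    (cnt p b < cnt p a ∧ cnt a b + cnt p a = M + cnt p b + 1) := by
  have e : b - a = (b - p) - (a - p) := by ring
  have e' : a - b = (a - p) - (b - p) := by ring
  rcases le_or_gt (cnt p a) (cnt p b) with h | h
  · left
    refine ⟨h, ?_⟩
    unfold cnt at *
    rw [e, ZMod.val_sub (by omega)]; omega
  · right
    refine ⟨h, ?_⟩
    have h1 : (a - b).val = (a - p).val - (b - p).val := by
      rw [e', ZMod.val_sub (by unfold cnt at h; omega)]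
    have h2 : a - b ≠ 0 := by
      intro h0
      rw [h0] at h1
      unfold cnt at h
      simp at h1
      omega
    have h3 : (b - a).val = M - (a - b).val := by
      have : b - a = -(a - b) := by ring
      rw [this]
      have : NeZero (a - b) := ⟨h2⟩
      rw [ZMod.val_neg_of_ne_zero]
    have := ZMod.val_lt (a - p)
    unfold cnt at *
    omega

theorem noCross [NeZero M] {S : Set (Sym2 (ZMod M))} (hS : IsTiling S) (p : ZMod M)
    {a b c d : ZMod M} (h1 : s(a, c) ∈ S) (h2 : s(b, d) ∈ S)
    (hab : cnt p a < cnt p b) (hbc : cnt p b < cnt p c) (hcd : cnt p c < cnt p d) : False := by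
  apply hS.2 _ h1 _ h2
  refine ⟨a, b, c, d, rfl, rfl, ?_, ?_⟩
  · simp only [List.nodup_cons, List.mem_cons, List.not_mem_nil, not_or]
    refine ⟨⟨?_, ?_, ?_, by simp⟩, ⟨?_, ?_, by simp⟩, ⟨?_, by simp⟩, by simp⟩ <;>
      (rintro rfl; omega)
  · have k1 := cnt_eq p a b
    have k2 := cnt_eq p b c
    have k3 := cnt_eq p c d
    have k4 := cnt_eq p d a
    have := cnt_le p d
    simp only [List.rotate, List.length_cons, List.length_nil]
    simp
    unfold cnt at *
    omega

theorem ne_of_mem {S : Set (Sym2 (ZMod M))} (hS : IsTiling S) {a b : ZMod M}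
    (h : s(a, b) ∈ S) : a ≠ b := by
  have := hS.1 _ h
  simpa using this

/-- Clockwise order on the diagonals at `v`. -/
def FLt (v : ZMod M) (d e : Sym2 (ZMod M)) : Prop :=
  ∃ a b : ZMod M, d = s(v, a) ∧ e = s(v, b) ∧ cnt v a < cnt v b

/-- `e` directly follows `d` in the fan at `v`. -/
def Cov (S : Set (Sym2 (ZMod M))) (v : ZMod M) (d e : Sym2 (ZMod M)) : Prop :=
  d ∈ S ∧ e ∈ S ∧ FLt v d e ∧ ∀ f ∈ S, FLt v d f → FLt v f e → False

theorem flt_mk {v a b : ZMod M} : FLt v s(v, a) s(v, b) ↔ cnt v a < cnt v b := by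
  constructor
  · rintro ⟨a', b', h1, h2, h⟩
    rw [Sym2.congr_right] at h1 h2
    subst h1 h2
    exact h
  · intro h
    exact ⟨a, b, rfl, rfl, h⟩

theorem FLt.left {v : ZMod M} {d e : Sym2 (ZMod M)} (h : FLt v d e) : v ∈ d := by
  obtain ⟨a, b, rfl, rfl, h⟩ := h; simp
theorem FLt.right {v : ZMod M} {d e : Sym2 (ZMod M)} (h : FLt v d e) : v ∈ e := by
  obtain ⟨a, b, rfl, rfl, h⟩ := h; simp
theorem FLt.irrefl {v : ZMod M} {d : Sym2 (ZMod M)} (h : FLt v d d) : False := by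
  obtain ⟨a, ha⟩ := h.left
  rw [ha, flt_mk] at h
  omega
theorem FLt.ne {v : ZMod M} {d e : Sym2 (ZMod M)} (h : FLt v d e) : d ≠ e := by
  rintro rfl; exact h.irrefl
theorem FLt.trans {v : ZMod M} {d e f : Sym2 (ZMod M)} (h : FLt v d e) (h' : FLt v e f) :
    FLt v d f := by
  obtain ⟨a, b, rfl, rfl, h⟩ := h
  obtain ⟨c, rfl⟩ := h'.right
  rw [flt_mk] at *
  omega
theorem flt_total [NeZero M] {v : ZMod M} {d e : Sym2 (ZMod M)} (h : v ∈ d) (h' : v ∈ e) :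
    FLt v d e ∨ d = e ∨ FLt v e d := by
  obtain ⟨a, rfl⟩ := h
  obtain ⟨b, rfl⟩ := h'
  rw [flt_mk, flt_mk]
  rcases lt_trichotomy (cnt v a) (cnt v b) with h | h | h
  · exact Or.inl h
  · rw [cnt_inj h]; simp
  · exact Or.inr (Or.inr h)

theorem common_unique {d e : Sym2 (ZMod M)} (hne : d ≠ e) {v w : ZMod M}
    (h1 : v ∈ d) (h2 : v ∈ e) (h3 : w ∈ d) (h4 : w ∈ e) : v = w := by
  by_contra h
  exact hne (Sym2.eq_of_ne_mem h h1 h3 h2 h4)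

theorem mem_tile_left (S : Set (Sym2 (ZMod M))) (x b : ZMod M) : x ∈ tileAt S x b := by
  refine ⟨?_, ?_⟩
  · have := cnt_pos' x b; rw [cnt_self]; omega
  · intro c e _ _ _ _ ⟨h, _⟩
    have := cnt_pos' x c; rw [cnt_self] at h; omega

theorem mem_tile_right (S : Set (Sym2 (ZMod M))) (x b : ZMod M) : b ∈ tileAt S x b := by
  refine ⟨le_rfl, ?_⟩
  intro c e _ _ _ h1 ⟨_, h⟩
  omega

theorem tile_of_cov [NeZero M] {S : Set (Sym2 (ZMod M))} (hS : IsTiling S) {x a b : ZMod M}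
    (h : Cov S x s(x, a) s(x, b)) : a ∈ tileAt S x b := by
  obtain ⟨ha, hb, hlt, hc⟩ := h
  rw [flt_mk] at hlt
  refine ⟨hlt.le, ?_⟩
  rintro c e hce hne h1 h2 ⟨h3, h4⟩
  by_cases hcx : c = x
  · subst hcx
    have : cnt c e ≠ cnt c b := by
      intro h; apply hne; rw [cnt_inj h]
    exact hc _ hce (flt_mk.2 h4) (flt_mk.2 (by omega))
  · have h5 : cnt x c ≠ cnt x x := fun h => hcx (cnt_inj h)
    have h6 := cnt_pos' x c
    rw [cnt_self] at h5
    exact noCross hS x ha hce (by rw [cnt_self]; omega) h3 h4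

theorem tile_of_cov' [NeZero M] {S : Set (Sym2 (ZMod M))} (hS : IsTiling S) {x y c : ZMod M}
    (h : Cov S y s(y, x) s(y, c)) : c ∈ tileAt S x y := by
  obtain ⟨ha, hb, hlt, hc⟩ := h
  rw [flt_mk] at hlt
  have e1 := cnt_eq x y x
  have e2 := cnt_eq x y c
  have e3 := cnt_self x
  have e4 := cnt_pos' x y
  have e5 := cnt_le x c
  have e6 : cnt x y ≠ cnt x x := fun h => ne_of_mem hS ha (cnt_inj h)
  refine ⟨by omega, ?_⟩
  rintro d e hce hne h1 h2 ⟨h3, h4⟩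
  by_cases hcx : e = y
  · subst hcx
    have f1 : cnt x d ≠ cnt x x := by
      intro h; apply hne; rw [cnt_inj h]
    have f2 := cnt_pos' x d
    have f3 := cnt_eq x e d
    have f4 := cnt_le x d
    exact hc _ (Sym2.eq_swap ▸ hce) (flt_mk.2 (by omega)) (flt_mk.2 (by omega))
  · have h5 : cnt x e ≠ cnt x y := fun h => hcx (cnt_inj h)
    exact noCross hS x hce (Sym2.eq_swap ▸ hb) h3 h4 (by omega)

theorem cov_of_tile [NeZero M] {S : Set (Sym2 (ZMod M))} (hS : IsTiling S) {p q x a b c : ZMod M}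
    (hpq : s(p, q) ∈ S) (hx : x ∈ tileAt S p q) (ha : a ∈ tileAt S p q) (hb : b ∈ tileAt S p q)
    (hxa : s(x, a) ∈ S) (hc : s(x, c) ∈ S)
    (h1 : cnt x a < cnt x c) (h2 : cnt x c < cnt x b) : False := by
  have hxane := ne_of_mem hS hxa
  have l1 : cnt x a ≠ cnt x x := fun h => hxane (cnt_inj h).symm
  have l2 := cnt_self x
  have l3 := cnt_pos' x a
  have e1 := cnt_eq p x a
  have e2 := cnt_eq p x b
  have e3 := cnt_eq p x c
  have ha1 := ha.1
  have hb1 := hb.1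
  have hx1 := hx.1
  have e4 := cnt_le p a
  have e5 := cnt_le p b
  have e6 := cnt_le p c
  have e7 := cnt_le p x
  have e8 := cnt_pos' p x
  have e9 := cnt_pos' p a
  have e10 := cnt_pos' p b
  have e11 := cnt_pos' p c
  have e12 := cnt_self p
  by_cases hcq : cnt p c ≤ cnt p q
  · have hne : s(x, c) ≠ s(p, q) := by
      intro h
      rw [Sym2.eq_iff] at h
      rcases h with ⟨rfl, rfl⟩ | ⟨rfl, rfl⟩ <;> omega
    rcases le_total (cnt p x) (cnt p c) with h | h
    · have := ha.2 x c hc hne h hcq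
      have := hb.2 x c hc hne h hcq
      omega
    · have hc' : s(c, x) ∈ S := Sym2.eq_swap ▸ hc
      have hne' : s(c, x) ≠ s(p, q) := by rwa [Sym2.eq_swap]
      have := ha.2 c x hc' hne' h hx1
      have := hb.2 c x hc' hne' h hx1
      omega
  · have n1 : x ≠ p := by
      rintro rfl; omega
    have n2 : x ≠ q := by
      rintro rfl; omega
    have n1' : cnt p x ≠ cnt p p := fun h => n1 (cnt_inj h)
    have n2' : cnt p x ≠ cnt p q := fun h => n2 (cnt_inj h)
    exact noCross hS p hpq hc (by omega) (by omega) (by omega)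

theorem cov_of_qarrin [NeZero M] {S : Set (Sym2 (ZMod M))} (hS : IsTiling S) {T : Set (ZMod M)}
    {v : ZMod M} {d e : Sym2 (ZMod M)} (hT : IsTile S T) (hd : IsBounding S T d)
    (he : IsBounding S T e) (h : FLt v d e) : Cov S v d e := by
  refine ⟨hd.1, he.1, h, ?_⟩
  intro f hf hdf hfe
  obtain ⟨a, b, rfl, rfl, h⟩ := h
  obtain ⟨c, rfl⟩ := hfe.left
  obtain ⟨p, q, hpq, rfl⟩ := hT
  exact cov_of_tile hS hpq (hd.2 v (by simp)) (hd.2 a (by simp)) (he.2 b (by simp)) hd.1 hf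
    (flt_mk.1 hdf) (flt_mk.1 hfe)

theorem qarr_iff [NeZero M] {S : Set (Sym2 (ZMod M))} (hS : IsTiling S) (d e : Sym2 (ZMod M)) :
    QArr S d e ↔ ∃ v, Cov S v d e := by
  constructor
  · rintro ⟨T, hT, hd, he, v, a, b, h⟩
    exact ⟨v, cov_of_qarrin hS hT hd he ⟨a, b, h⟩⟩
  · rintro ⟨v, h⟩
    obtain ⟨a, b, rfl, rfl, hab⟩ := h.2.2.1
    have := tile_of_cov hS h
    refine ⟨tileAt S v b, ⟨v, b, h.2.1, rfl⟩, ⟨h.1, ?_⟩, ⟨h.2.1, ?_⟩, v, a, b, rfl, rfl, hab⟩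
    · simp [this, mem_tile_left]
    · simp [mem_tile_right, mem_tile_left]

theorem qrel_iff [NeZero M] {S : Set (Sym2 (ZMod M))} (hS : IsTiling S) {d e f : Sym2 (ZMod M)}
    {v w : ZMod M} (h1 : Cov S v d e) (h2 : Cov S w e f) : QRel S d e f ↔ v ≠ w := by
  constructor
  · rintro ⟨T, ⟨hT, hd, he, _⟩, ⟨_, _, hf, _⟩⟩ rfl
    have := cov_of_qarrin hS hT hd hf (h1.2.2.1.trans h2.2.2.1)
    exact this.2.2.2 e he.1 h1.2.2.1 h2.2.2.1
  · intro hne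
    have hv := h1.2.2.1.right
    have hw := h2.2.2.1.left
    have he : e = s(v, w) := (Sym2.mem_and_mem_iff hne).1 ⟨hv, hw⟩
    subst he
    obtain ⟨a, rfl⟩ := h1.2.2.1.left
    obtain ⟨c, rfl⟩ := h2.2.2.1.right
    have m1 := tile_of_cov hS h1
    have h2' := h2
    rw [Sym2.eq_swap] at h2'
    have m2 := tile_of_cov' hS h2'
    refine ⟨tileAt S v w, ⟨⟨v, w, h1.2.1, rfl⟩, ⟨h1.1, ?_⟩, ⟨h1.2.1, ?_⟩, h1.2.2.1.elim ?_⟩,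
      ⟨⟨v, w, h1.2.1, rfl⟩, ⟨h1.2.1, ?_⟩, ⟨h2.2.1, ?_⟩, h2.2.2.1.elim ?_⟩⟩
    · simp [m1, mem_tile_left]
    · simp [mem_tile_right, mem_tile_left]
    · exact fun a h => ⟨v, a, h⟩
    · simp [mem_tile_right, mem_tile_left]
    · simp [m2, mem_tile_right]
    · exact fun a h => ⟨w, a, h⟩

/-- `Cov` on the vertices of the quiver. -/
def CovV (S : Set (Sym2 (ZMod M))) (v : ZMod M) (d e : {d : Sym2 (ZMod M) // d ∈ S}) : Prop :=
  Cov S v d.1 e.1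

/-- `FLt` on the vertices of the quiver. -/
def FLtV (S : Set (Sym2 (ZMod M))) (v : ZMod M) (d e : {d : Sym2 (ZMod M) // d ∈ S}) : Prop :=
  FLt v d.1 e.1

theorem CovV.flt {S : Set (Sym2 (ZMod M))} {v : ZMod M} {d e : {d : Sym2 (ZMod M) // d ∈ S}}
    (h : CovV S v d e) : FLt v d.1 e.1 := h.2.2.1

theorem CovV.not_between {S : Set (Sym2 (ZMod M))} {v : ZMod M}
    {d e : {d : Sym2 (ZMod M) // d ∈ S}}
    (h : CovV S v d e) (f : {d : Sym2 (ZMod M) // d ∈ S}) (h1 : FLt v d.1 f.1)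
    (h2 : FLt v f.1 e.1) : False := h.2.2.2 f.1 f.2 h1 h2

theorem CovV.ne {S : Set (Sym2 (ZMod M))} {v : ZMod M} {d e : {d : Sym2 (ZMod M) // d ∈ S}}
    (h : CovV S v d e) : d ≠ e := fun h' => h.flt.ne (congrArg Subtype.val h')

theorem arr_iff [NeZero M] {S : Set (Sym2 (ZMod M))} (hS : IsTiling S)
    (d e : {d : Sym2 (ZMod M) // d ∈ S}) :
    (tilingPair S).Arr d e ↔ ∃ v, CovV S v d e := qarr_iff hS d.1 e.1

theorem rel_iff [NeZero M] {S : Set (Sym2 (ZMod M))} (hS : IsTiling S)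
    {d e f : {d : Sym2 (ZMod M) // d ∈ S}} {v w : ZMod M}
    (h1 : CovV S v d e) (h2 : CovV S w e f) : (tilingPair S).Rel d e f ↔ v ≠ w :=
  qrel_iff hS h1 h2

theorem chain_of_perm [NeZero M] {S : Set (Sym2 (ZMod M))} (hS : IsTiling S) {v : ZMod M}
    (t : List {d : Sym2 (ZMod M) // d ∈ S}) :
    ∀ x y : {d : Sym2 (ZMod M) // d ∈ S}, (x :: y :: t).IsChain (tilingPair S).Arr →
      (∀ a b c, [a, b, c] <:+: (x :: y :: t) → ¬ (tilingPair S).Rel a b c) →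
      CovV S v x y → (x :: y :: t).IsChain (CovV S v) := by
  induction t with
  | nil => intro x y _ _ h; simpa using h
  | cons z t ih =>
    intro x y hc hr h
    rw [List.isChain_cons_cons] at hc ⊢
    refine ⟨h, ih y z hc.2 (fun a b c habc => hr a b c ?_) ?_⟩
    · obtain ⟨p, q, hpq⟩ := habc
      exact ⟨x :: p, q, by simp [← hpq]⟩
    have hyz := (List.isChain_cons_cons.1 hc.2).1
    obtain ⟨w, hw⟩ := (arr_iff hS _ _).1 hyz
    have := hr x y z ⟨[], t, by simp⟩
    rw [rel_iff hS h hw] at this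
    push Not at this
    subst this
    exact hw

theorem permPath_iff [NeZero M] {S : Set (Sym2 (ZMod M))} (hS : IsTiling S)
    (l : List {d : Sym2 (ZMod M) // d ∈ S}) :
    (tilingPair S).PermPath l ↔ 2 ≤ l.length ∧ ∃ v, l.IsChain (CovV S v) := by
  constructor
  · rintro ⟨h2, hc, hr⟩
    refine ⟨h2, ?_⟩
    match l, h2, hc, hr with
    | x :: y :: t, _, hc, hr =>
      obtain ⟨v, hv⟩ := (arr_iff hS _ _).1 (List.isChain_cons_cons.1 hc).1
      exact ⟨v, chain_of_perm hS t x y hc hr hv⟩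
  · rintro ⟨h2, v, hc⟩
    refine ⟨h2, hc.imp (fun a b h => (arr_iff hS _ _).2 ⟨v, h⟩), ?_⟩
    intro x y z hxyz
    obtain ⟨p, q, rfl⟩ := hxyz
    have := hc.left_of_append.right_of_append
    simp only [List.isChain_cons_cons] at this
    rw [rel_iff hS this.1 this.2.1]
    simp

theorem chain_pairwise {S : Set (Sym2 (ZMod M))} {v : ZMod M}
    {l : List {d : Sym2 (ZMod M) // d ∈ S}} (h : l.IsChain (CovV S v)) :
    l.Pairwise (FLtV S v) := by
  have : IsTrans {d : Sym2 (ZMod M) // d ∈ S} (FLtV S v) := ⟨fun _ _ _ h h' => FLt.trans h h'⟩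
  exact (h.imp (fun _ _ h => h.flt)).pairwise

theorem pairwise_nodup {S : Set (Sym2 (ZMod M))} {v : ZMod M}
    {l : List {d : Sym2 (ZMod M) // d ∈ S}} (h : l.Pairwise (FLtV S v)) : l.Nodup :=
  h.imp (fun h e => FLt.ne h (congrArg Subtype.val e))

theorem fan_chain [NeZero M] {S : Set (Sym2 (ZMod M))} {v : ZMod M}
    (l : List {d : Sym2 (ZMod M) // d ∈ S}) (hp : l.Pairwise (FLtV S v))
    (hm : ∀ z : {d : Sym2 (ZMod M) // d ∈ S}, v ∈ z.1 → z ∈ l ∨ ∀ y ∈ l, FLt v z.1 y.1) :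
    l.IsChain (CovV S v) := by
  induction l with
  | nil => exact List.isChain_nil
  | cons x t ih =>
    have hp' := List.pairwise_cons.1 hp
    have ht := ih hp'.2 (by
      intro z hz
      rcases hm z hz with h | h
      · rcases List.mem_cons.1 h with rfl | h
        · exact Or.inr hp'.1
        · exact Or.inl h
      · exact Or.inr fun y hy => h y (List.mem_cons_of_mem _ hy))
    cases t with
    | nil => simp
    | cons y t =>
      refine List.isChain_cons_cons.2 ⟨⟨x.2, y.2, hp'.1 y (by simp), ?_⟩, ht⟩
      intro f hf h1 h2
      rcases hm ⟨f, hf⟩ h1.right with h | h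
      · rcases List.mem_cons.1 h with rfl | h
        · exact h1.irrefl
        · rcases List.mem_cons.1 h with rfl | h
          · exact h2.irrefl
          · exact (h2.trans ((List.pairwise_cons.1 hp'.2).1 _ h)).irrefl
      · exact (h1.trans (h x (by simp))).irrefl

theorem exists_succ [NeZero M] {S : Set (Sym2 (ZMod M))} {v : ZMod M}
    {d e : {d : Sym2 (ZMod M) // d ∈ S}} (h : FLt v d.1 e.1) : ∃ f, CovV S v d f := by
  obtain ⟨d, hd⟩ := d
  obtain ⟨e, he⟩ := e
  obtain ⟨a, b, rfl, rfl, h⟩ := h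
  obtain ⟨c, ⟨hc1, hc2⟩, hc⟩ := Set.exists_min_image {c | s(v, c) ∈ S ∧ cnt v a < cnt v c} (cnt v)
    (Set.toFinite _) ⟨b, he, h⟩
  refine ⟨⟨s(v, c), hc1⟩, hd, hc1, flt_mk.2 hc2, ?_⟩
  intro f hf h1 h2
  obtain ⟨g, rfl⟩ := h1.right
  have := hc g ⟨hf, flt_mk.1 h1⟩
  have := flt_mk.1 h2
  omega

theorem exists_pred [NeZero M] {S : Set (Sym2 (ZMod M))} {v : ZMod M}
    {d e : {d : Sym2 (ZMod M) // d ∈ S}} (h : FLt v d.1 e.1) : ∃ f, CovV S v f e := by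
  obtain ⟨d, hd⟩ := d
  obtain ⟨e, he⟩ := e
  obtain ⟨a, b, rfl, rfl, h⟩ := h
  obtain ⟨c, ⟨hc1, hc2⟩, hc⟩ := Set.exists_max_image {c | s(v, c) ∈ S ∧ cnt v c < cnt v b} (cnt v)
    (Set.toFinite _) ⟨a, hd, h⟩
  refine ⟨⟨s(v, c), hc1⟩, hc1, he, flt_mk.2 hc2, ?_⟩
  intro f hf h1 h2
  obtain ⟨g, rfl⟩ := h1.right
  have := hc g ⟨hf, flt_mk.1 h2⟩
  have := flt_mk.1 h1
  omega

theorem chain_mem [NeZero M] {S : Set (Sym2 (ZMod M))} {v : ZMod M}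
    {d : {d : Sym2 (ZMod M) // d ∈ S}} (t : List {d : Sym2 (ZMod M) // d ∈ S}) :
    ∀ x : {d : Sym2 (ZMod M) // d ∈ S}, (x :: t).IsChain (CovV S v) → FLt v x.1 d.1 →
      d ∈ x :: t ∨ ∀ y ∈ x :: t, FLt v y.1 d.1 := by
  induction t with
  | nil => intro x _ h; right; simpa using h
  | cons y t ih =>
    intro x hc h
    rw [List.isChain_cons_cons] at hc
    rcases flt_total h.right hc.1.flt.right with h1 | h1 | h1
    · exact (hc.1.not_between d h h1).elim
    · left; simp [Subtype.ext h1]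
    · rcases ih y hc.2 h1 with h2 | h2
      · left; exact List.mem_cons_of_mem _ h2
      · right
        intro z hz
        rcases List.mem_cons.1 hz with rfl | hz
        · exact h
        · exact h2 z hz

theorem succ_unique [NeZero M] {S : Set (Sym2 (ZMod M))} {v : ZMod M}
    {d e f : {d : Sym2 (ZMod M) // d ∈ S}} (h : CovV S v d e) (h' : CovV S v d f) : e = f := by
  rcases flt_total h.flt.right h'.flt.right with h1 | h1 | h1
  · exact (h'.not_between e h.flt h1).elim
  · exact Subtype.ext h1
  · exact (h.not_between f h'.flt h1).elim

theorem pred_unique [NeZero M] {S : Set (Sym2 (ZMod M))} {v : ZMod M}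
    {d e f : {d : Sym2 (ZMod M) // d ∈ S}} (h : CovV S v e d) (h' : CovV S v f d) : e = f := by
  rcases flt_total h.flt.left h'.flt.left with h1 | h1 | h1
  · exact (h.not_between f h1 h'.flt).elim
  · exact Subtype.ext h1
  · exact (h'.not_between e h1 h.flt).elim

/-- The common endpoint of two consecutive diagonals is unique. -/
theorem covV_unique {S : Set (Sym2 (ZMod M))} {v w : ZMod M}
    {d e : {d : Sym2 (ZMod M) // d ∈ S}} (h : CovV S v d e) (h1 : w ∈ d.1) (h2 : w ∈ e.1) :
    w = v :=
  common_unique h.flt.ne h1 h2 h.flt.left h.flt.right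

theorem isFan_pairwise {S : Set (Sym2 (ZMod M))} {v : ZMod M}
    {l : List {d : Sym2 (ZMod M) // d ∈ S}} (h : IsFan S v l) : l.Pairwise (FLtV S v) := h.2.2

theorem fan_ne_nil {S : Set (Sym2 (ZMod M))} {v : ZMod M} (hv : ¬ Isolated S v)
    {l : List {d : Sym2 (ZMod M) // d ∈ S}} (h : IsFan S v l) : l ≠ [] := by
  rintro rfl
  apply hv
  intro d hd hvd
  have := (h.2.1 ⟨d, hd⟩).2 hvd
  simp at this

theorem triv_of_leaf [NeZero M] {S : Set (Sym2 (ZMod M))} (hS : IsTiling S) {v : ZMod M}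
    {α : {d : Sym2 (ZMod M) // d ∈ S}} (h : IsFan S v [α]) : (tilingPair S).TrivPermVtx α := by
  have hvα : v ∈ α.1 := (h.2.1 α).1 (by simp)
  have hl : ∀ d : {d : Sym2 (ZMod M) // d ∈ S}, v ∈ d.1 → d = α := by
    intro d hd; simpa using (h.2.1 d).2 hd
  obtain ⟨u, hu⟩ := hvα
  have key : ∀ w d, w ∈ α.1 → w ∈ d.1 → d ≠ α → w = u := by
    intro w d h1 h2 h3
    rw [hu, Sym2.mem_iff] at h1
    rcases h1 with rfl | h1
    · exact (h3 (hl d h2)).elim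
    · exact h1
  have kout : ∀ y, (tilingPair S).Arr α y → CovV S u α y := by
    intro y hy
    obtain ⟨w, hw⟩ := (arr_iff hS _ _).1 hy
    have := key w y hw.flt.left hw.flt.right hw.ne.symm
    subst this; exact hw
  have kin : ∀ y, (tilingPair S).Arr y α → CovV S u y α := by
    intro y hy
    obtain ⟨w, hw⟩ := (arr_iff hS _ _).1 hy
    have := key w y hw.flt.right hw.flt.left hw.ne
    subst this; exact hw
  refine ⟨fun y hy z hz => succ_unique (kout y hy) (kout z hz),
    fun y hy z hz => pred_unique (kin y hy) (kin z hz), fun x y hx hy => ?_⟩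
  rw [rel_iff hS (kin x hx) (kout y hy)]
  simp

theorem thread_of_fan [NeZero M] {S : Set (Sym2 (ZMod M))} (hS : IsTiling S) {v : ZMod M}
    (hv : ¬ Isolated S v) {l : List {d : Sym2 (ZMod M) // d ∈ S}} (h : IsFan S v l) :
    (tilingPair S).PermThread l := by
  have hne := fan_ne_nil hv h
  match l, hne, h with
  | [α], _, h => exact Or.inr ⟨α, rfl, triv_of_leaf hS h⟩
  | x :: y :: t, _, h =>
    left
    have hc := fan_chain _ (isFan_pairwise h) (fun z hz => Or.inl ((h.2.1 z).2 hz))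
    have hxy := (List.isChain_cons_cons.1 hc).1
    refine ⟨(permPath_iff hS _).2 ⟨by simp, v, hc⟩, ?_, ?_⟩
    · intro w hw
      obtain ⟨_, v', hc'⟩ := (permPath_iff hS _).1 hw
      have hxy' : CovV S v' x y := by
        rw [List.cons_append, List.cons_append] at hc'
        exact (List.isChain_cons_cons.1 hc').1
      have := covV_unique hxy hxy'.flt.left hxy'.flt.right
      subst this
      have hp := chain_pairwise hc'
      have hd := pairwise_nodup hp
      have hwx : FLt v' x.1 w.1 := (List.pairwise_append.1 hp).2.2 x (by simp) w (by simp)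
      have hwl := (h.2.1 w).2 hwx.right
      exact (List.disjoint_of_nodup_append hd) hwl (by simp)
    · intro w hw
      obtain ⟨_, v', hc'⟩ := (permPath_iff hS _).1 hw
      have hc'' := List.isChain_cons_cons.1 hc'
      have hxy' : CovV S v' x y := (List.isChain_cons_cons.1 hc''.2).1
      have := covV_unique hxy hxy'.flt.left hxy'.flt.right
      subst this
      have hd := pairwise_nodup (chain_pairwise hc')
      exact (List.nodup_cons.1 hd).1 ((h.2.1 w).2 hc''.1.flt.left)

theorem fan_of_maximal [NeZero M] {S : Set (Sym2 (ZMod M))} (hS : IsTiling S)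
    {l : List {d : Sym2 (ZMod M) // d ∈ S}} (h : (tilingPair S).PermPath l)
    (hr : ∀ w, ¬ (tilingPair S).PermPath (l ++ [w])) (hl : ∀ w, ¬ (tilingPair S).PermPath (w :: l)) :
    ∃! v : ZMod M, ¬ Isolated S v ∧ IsFan S v l := by
  obtain ⟨h2, v, hc⟩ := (permPath_iff hS _).1 h
  match l, h2, hc, h, hr, hl with
  | x :: y :: t, h2, hc, h, hr, hl =>
    have hxy := (List.isChain_cons_cons.1 hc).1
    have hp := chain_pairwise hc
    refine ⟨v, ⟨fun hi => hi x.1 x.2 hxy.flt.left, pairwise_nodup hp, ?_, hp⟩, ?_⟩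
    · intro d
      constructor
      · intro hd
        rcases List.mem_cons.1 hd with rfl | hd
        · exact hxy.flt.left
        · exact ((List.pairwise_cons.1 hp).1 d hd).right
      · intro hd
        rcases flt_total hd hxy.flt.left with h1 | h1 | h1
        · obtain ⟨f, hf⟩ := exists_pred h1
          exact (hl f ((permPath_iff hS _).2 ⟨by simp, v, List.isChain_cons_cons.2 ⟨hf, hc⟩⟩)).elim
        · simp [Subtype.ext h1]
        · rcases chain_mem _ _ hc h1 with h3 | h3
          · exact h3
          · exfalso
            have hz := List.getLast_mem (l := x :: y :: t) (by simp)
            obtain ⟨f, hf⟩ := exists_succ (h3 _ hz)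
            apply hr f
            refine (permPath_iff hS _).2 ⟨by simp, v, ?_⟩
            refine List.isChain_append.2 ⟨hc, by simp, ?_⟩
            intro a ha b hb
            rw [List.getLast?_eq_some_getLast (by simp)] at ha
            simp only [Option.mem_def, Option.some.injEq, List.head?_cons] at ha hb
            subst ha hb
            exact hf
    · rintro v' ⟨_, hf⟩
      exact covV_unique hxy ((hf.2.1 x).1 (by simp)) ((hf.2.1 y).1 (by simp))

theorem isFan_single {S : Set (Sym2 (ZMod M))} {v : ZMod M} {α : {d : Sym2 (ZMod M) // d ∈ S}}
    (hv : v ∈ α.1) (h : ∀ d : {d : Sym2 (ZMod M) // d ∈ S}, v ∈ d.1 → d = α) :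
    IsFan S v [α] := by
  refine ⟨by simp, ?_, by simp⟩
  intro d
  simp only [List.mem_singleton]
  exact ⟨fun e => e ▸ hv, h d⟩

theorem leaf_of_triv [NeZero M] {S : Set (Sym2 (ZMod M))} (hS : IsTiling S)
    {α : {d : Sym2 (ZMod M) // d ∈ S}} (h : (tilingPair S).TrivPermVtx α) :
    ∃ v, v ∈ α.1 ∧ IsFan S v [α] := by
  obtain ⟨ho, hi, hr⟩ := h
  obtain ⟨x, y, hα⟩ : ∃ x y, α.1 = s(x, y) := by
    induction h : α.1 using Sym2.ind with | _ x y => exact ⟨x, y, rfl⟩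
  have hxy : x ≠ y := ne_of_mem hS (hα ▸ α.2)
  have hx : x ∈ α.1 := by simp [hα]
  have hy : y ∈ α.1 := by simp [hα]
  by_contra hcon
  push Not at hcon
  have step : ∀ w, w ∈ α.1 → ∃ d, CovV S w d α ∨ CovV S w α d := by
    intro w hw
    by_contra hno
    push Not at hno
    apply hcon w hw
    apply isFan_single hw
    intro d hd
    rcases flt_total hd hw with h1 | h1 | h1
    · obtain ⟨f, hf⟩ := exists_pred h1
      exact ((hno f).1 hf).elim
    · exact Subtype.ext h1
    · obtain ⟨f, hf⟩ := exists_succ h1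
      exact ((hno f).2 hf).elim
  obtain ⟨d, hd⟩ := step x hx
  obtain ⟨e, he⟩ := step y hy
  rcases hd with hd | hd <;> rcases he with he | he
  · have := hi ((arr_iff hS _ _).2 ⟨x, hd⟩) ((arr_iff hS _ _).2 ⟨y, he⟩)
    subst this
    exact hxy (covV_unique he hd.flt.left hx)
  · exact hr d e ((arr_iff hS _ _).2 ⟨x, hd⟩) ((arr_iff hS _ _).2 ⟨y, he⟩) ((rel_iff hS hd he).2 hxy)
  · exact hr e d ((arr_iff hS _ _).2 ⟨y, he⟩) ((arr_iff hS _ _).2 ⟨x, hd⟩)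
      ((rel_iff hS he hd).2 hxy.symm)
  · have := ho ((arr_iff hS _ _).2 ⟨x, hd⟩) ((arr_iff hS _ _).2 ⟨y, he⟩)
    subst this
    exact hxy (covV_unique he hx hd.flt.right)

theorem leaf_unique [NeZero M] {S : Set (Sym2 (ZMod M))} (hS : IsTiling S)
    (hconn : (tilingPair S).Conn) (h2 : 2 ≤ S.ncard) {α : {d : Sym2 (ZMod M) // d ∈ S}}
    {v w : ZMod M} (hv : IsFan S v [α]) (hw : IsFan S w [α]) : v = w := by
  by_contra hne
  have hv1 : v ∈ α.1 := (hv.2.1 α).1 (by simp)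
  have hw1 : w ∈ α.1 := (hw.2.1 α).1 (by simp)
  have he : α.1 = s(v, w) := (Sym2.mem_and_mem_iff hne).1 ⟨hv1, hw1⟩
  obtain ⟨b, hb, hbne⟩ := Set.exists_ne_of_one_lt_ncard (by omega : 1 < S.ncard) α.1
  obtain ⟨p⟩ := hconn.preconnected α ⟨b, hb⟩
  have key : ∀ u (c : {d : Sym2 (ZMod M) // d ∈ S}), u ∈ α.1 → u ∈ c.1 → c = α := by
    intro u c h1 h2
    rw [he, Sym2.mem_iff] at h1
    rcases h1 with rfl | rfl
    · simpa using (hv.2.1 c).2 h2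
    · simpa using (hw.2.1 c).2 h2
  cases p with
  | nil => exact hbne rfl
  | cons hadj _ =>
    rw [SimpleGraph.fromRel_adj] at hadj
    obtain ⟨hn, h | h⟩ := hadj
    · obtain ⟨u, hu⟩ := (arr_iff hS _ _).1 h
      exact hn (key u _ hu.flt.left hu.flt.right).symm
    · obtain ⟨u, hu⟩ := (arr_iff hS _ _).1 h
      exact hn (key u _ hu.flt.right hu.flt.left).symm

/-- Lemma 3.8. Permitted threads of a tiling pair correspond to fans:
(1) if `S` has at least two diagonals, the permitted threads are in bijection with the
non-isolated marked points via fans; (2) if `S` has exactly one diagonal, there is a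
unique (trivial) permitted thread and both non-isolated marked points correspond to it;
(3) a permitted thread is trivial iff the corresponding marked point has valency one. -/
theorem fan_threads (M : ℕ) (hM : 2 ≤ M) (S : Set (Sym2 (ZMod M))) (hS : IsTiling S)
    (hconn : (tilingPair S).Conn) :
    ((2 ≤ S.ncard →
      (∀ v : ZMod M, ¬ Isolated S v →
        ∀ l, IsFan S v l → (tilingPair S).PermThread l) ∧
      (∀ l, (tilingPair S).PermThread l →
        ∃! v : ZMod M, ¬ Isolated S v ∧ IsFan S v l)) ∧
    (S.ncard = 1 →
      ∃ α : {d : Sym2 (ZMod M) // d ∈ S},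
        (∀ l, (tilingPair S).PermThread l ↔ l = [α]) ∧
        ∀ v : ZMod M, v ∈ α.1 → IsFan S v [α]) ∧
    (∀ (v : ZMod M) (l : List {d : Sym2 (ZMod M) // d ∈ S}),
      ¬ Isolated S v → IsFan S v l → (tilingPair S).PermThread l →
      (l.length = 1 ↔ {d : Sym2 (ZMod M) | d ∈ S ∧ v ∈ d}.encard = 1))) := by
  have : NeZero M := ⟨by omega⟩
  refine ⟨?_, ?_, ?_⟩
  · intro h2
    refine ⟨fun v hv l hl => thread_of_fan hS hv hl, ?_⟩
    rintro l (⟨hp, hr, hl⟩ | ⟨α, rfl, hα⟩)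
    · exact fan_of_maximal hS hp hr hl
    · obtain ⟨v, hv, hf⟩ := leaf_of_triv hS hα
      exact ⟨v, ⟨fun hi => hi α.1 α.2 hv, hf⟩, fun w hw => leaf_unique hS hconn h2 hw.2 hf⟩
  · intro h1
    obtain ⟨a, rfl⟩ := Set.ncard_eq_one.1 h1
    have huniq : ∀ d : {d : Sym2 (ZMod M) // d ∈ ({a} : Set (Sym2 (ZMod M)))}, d = ⟨a, rfl⟩ :=
      fun d => Subtype.ext d.2
    have hfan : ∀ v : ZMod M, v ∈ a →
        IsFan ({a} : Set (Sym2 (ZMod M))) v [⟨a, rfl⟩] :=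
      fun v hv => isFan_single hv fun d _ => huniq d
    refine ⟨⟨a, rfl⟩, ?_, hfan⟩
    intro l
    constructor
    · rintro (⟨hp, -, -⟩ | ⟨α, rfl, -⟩)
      · obtain ⟨h2, v, hc⟩ := (permPath_iff hS _).1 hp
        match l, h2, hc with
        | x :: y :: t, _, hc =>
          exact ((List.isChain_cons_cons.1 hc).1.ne ((huniq x).trans (huniq y).symm)).elim
      · rw [huniq α]
    · rintro rfl
      obtain ⟨v, hv⟩ : ∃ v, v ∈ a := by
        induction a using Sym2.ind with | _ x y => exact ⟨x, by simp⟩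
      exact Or.inr ⟨_, rfl, triv_of_leaf hS (hfan v hv)⟩
  · intro v l hv hf _
    rw [Set.encard_eq_one]
    constructor
    · intro h1
      obtain ⟨α, rfl⟩ := List.length_eq_one_iff.1 h1
      refine ⟨α.1, ?_⟩
      ext d
      constructor
      · rintro ⟨hd, hvd⟩
        have := (hf.2.1 ⟨d, hd⟩).2 hvd
        rw [List.mem_singleton] at this
        rw [← this]; rfl
      · rintro rfl
        exact ⟨α.2, (hf.2.1 α).1 (by simp)⟩
    · rintro ⟨d, hd⟩
      have hne := fan_ne_nil hv hf
      match l, hne, hf with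
      | [_], _, _ => rfl
      | x :: y :: t, _, hf =>
        exfalso
        have k : ∀ z ∈ x :: y :: t, z.1 = d := by
          intro z hz
          have : z.1 ∈ {d : Sym2 (ZMod M) | d ∈ S ∧ v ∈ d} := ⟨z.2, (hf.2.1 z).1 hz⟩
          rw [hd] at this
          exact this
        have hxy : x = y := Subtype.ext ((k x (by simp)).trans (k y (by simp)).symm)
        have hnd := hf.1
        simp [hxy] at hnd
end PaperTiling
end
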